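/- arXiv:1806.08806 — 4 statements merged into one kernel-verified Lean document; each statement's English description precedes it below -/
import Mathlib

section
/- Let M̄ be an L-structure, X an M̄-definable set, M₀ ≼ M̄ an elementary substructure, and μ a Keisler measure on X over M̄ which is smooth over M₀, i.e. μ is the unique Keisler measure on X over M̄ extending the restriction of μ to the algebra of subsets of X definable with parameters from M₀. Then for every M̄-definable subset Y ⊆ X and every ε > 0 there is a set Z ⊆ X definable with parameters from M₀ with μ(Z) < ε such that every complete type p over M₀ on X with Z ∉ p decides Y: either there is D ∈ p with D ⊆ Y, or there is D ∈ p with D ∩ Y = ∅. -/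
/-!
STATEMENT 5: Domination for smooth Keisler measures.  If `μ` is a Keisler measure on
a definable set `X` over `M̄` which is smooth over an elementary substructure `M₀`
(i.e. `μ` is the unique Keisler measure on `X` over `M̄` extending its restriction to
the `M₀`-definable subsets of `X`), then for every `M̄`-definable `Y ⊆ X` and `ε > 0`
there is an `M₀`-definable `Z ⊆ X` with `μ Z < ε` such that every complete type over
`M₀` on `X` avoiding `Z` decides `Y`.
-/

open FirstOrder

universe u v w

/-- `s ⊆ M` is definable by an `L`-formula in one free variable with parameters from `P`. -/
def DefOver (L : FirstOrder.Language.{u, v}) (M : Type w) [L.Structure M]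
    (P : Set M) (s : Set M) : Prop :=
  ∃ (k : ℕ) (φ : L.Formula (Unit ⊕ Fin k)) (c : Fin k → M),
    (∀ j, c j ∈ P) ∧ s = {a | φ.Realize (Sum.elim (fun _ => a) c)}

/-- A Keisler measure on the definable set `V` over `M`: a finitely additive
probability measure on the algebra of all `M`-definable (with parameters from `M`)
subsets of `V`. -/
def IsKeislerMeasureOn (L : FirstOrder.Language.{u, v}) (M : Type w) [L.Structure M]
    (V : Set M) (μ : Set M → ℝ) : Prop :=
  (∀ s, DefOver L M Set.univ s → s ⊆ V → 0 ≤ μ s) ∧ μ V = 1 ∧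
    ∀ s t, DefOver L M Set.univ s → DefOver L M Set.univ t → s ⊆ V → t ⊆ V →
      Disjoint s t → μ (s ∪ t) = μ s + μ t

/-- `μ` is smooth over `P ⊆ M` (on the definable set `V`): `μ` is the unique Keisler
measure on `V` over `M` extending the restriction of `μ` to the algebra of subsets of
`V` definable with parameters from `P`. -/
def IsSmoothOver (L : FirstOrder.Language.{u, v}) (M : Type w) [L.Structure M]
    (P : Set M) (V : Set M) (μ : Set M → ℝ) : Prop :=
  IsKeislerMeasureOn L M V μ ∧
    ∀ μ' : Set M → ℝ, IsKeislerMeasureOn L M V μ' →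
      (∀ s, DefOver L M P s → s ⊆ V → μ' s = μ s) →
      ∀ s, DefOver L M Set.univ s → s ⊆ V → μ' s = μ s

/-- A complete type over the parameter set `P` on the definable set `V`: an
ultrafilter on the Boolean algebra of subsets of `V` definable with parameters
from `P`. -/
def IsCompleteTypeOn (L : FirstOrder.Language.{u, v}) (M : Type w) [L.Structure M]
    (P : Set M) (V : Set M) (p : Set (Set M)) : Prop :=
  (∀ s ∈ p, DefOver L M P s ∧ s ⊆ V) ∧
  V ∈ p ∧ (∅ : Set M) ∉ p ∧
  (∀ s ∈ p, ∀ t ∈ p, s ∩ t ∈ p) ∧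
  (∀ s ∈ p, ∀ t, DefOver L M P t → t ⊆ V → s ⊆ t → t ∈ p) ∧
  (∀ s, DefOver L M P s → s ⊆ V → (s ∈ p ∨ (V \ s) ∈ p))

open Filter Topology

namespace DefOver

variable {L : FirstOrder.Language.{u, v}} {M : Type w} [L.Structure M] {P Q s t : Set M}

theorem mono (h : DefOver L M P s) (hPQ : P ⊆ Q) : DefOver L M Q s := by
  obtain ⟨k, φ, c, hc, rfl⟩ := h
  exact ⟨k, φ, c, fun j => hPQ (hc j), rfl⟩

theorem compl (h : DefOver L M P s) : DefOver L M P sᶜ := by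
  obtain ⟨k, φ, c, hc, rfl⟩ := h
  refine ⟨k, φ.not, c, hc, ?_⟩
  ext a
  simp [FirstOrder.Language.Formula.realize_not]

theorem inter (hs : DefOver L M P s) (ht : DefOver L M P t) : DefOver L M P (s ∩ t) := by
  obtain ⟨k, φ, c, hc, rfl⟩ := hs
  obtain ⟨l, ψ, d, hd, rfl⟩ := ht
  refine ⟨k + l, φ.relabel (Sum.map id (Fin.castAdd l)) ⊓ ψ.relabel (Sum.map id (Fin.natAdd k)),
    Fin.append c d, fun j => ?_, ?_⟩
  · refine Fin.addCases (fun i => ?_) (fun i => ?_) j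
    · simpa using hc i
    · simpa using hd i
  · ext a
    have h₁ : (Sum.elim (fun _ => a) (Fin.append c d) : Unit ⊕ Fin (k + l) → M) ∘
        Sum.map id (Fin.castAdd l) = Sum.elim (fun _ => a) c := by
      ext (i | i) <;> simp
    have h₂ : (Sum.elim (fun _ => a) (Fin.append c d) : Unit ⊕ Fin (k + l) → M) ∘
        Sum.map id (Fin.natAdd k) = Sum.elim (fun _ => a) d := by
      ext (i | i) <;> simp
    simp [FirstOrder.Language.Formula.realize_inf, FirstOrder.Language.Formula.realize_relabel,
      h₁, h₂]

theorem diff (hs : DefOver L M P s) (ht : DefOver L M P t) : DefOver L M P (s \ t) :=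
  hs.inter ht.compl

theorem union (hs : DefOver L M P s) (ht : DefOver L M P t) : DefOver L M P (s ∪ t) := by
  simpa [Set.compl_inter] using (hs.compl.inter ht.compl).compl

end DefOver

/-- A finitely additive function on an algebra `A` of sets agrees on any finite subfamily of `A`
with a finitely supported measure on all sets, whose value at `Y` is at least that of some member
of `A` covering `Y`. -/
theorem exists_additive_agreeing_on_finset {M : Type w} {A : Set (Set M)} {μ : Set M → ℝ}
    (hempty : ∅ ∈ A) (hinter : ∀ s ∈ A, ∀ t ∈ A, s ∩ t ∈ A) (hdiff : ∀ s ∈ A, ∀ t ∈ A, s \ t ∈ A)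
    (hunion : ∀ s ∈ A, ∀ t ∈ A, s ∪ t ∈ A) (hnonneg : ∀ s ∈ A, 0 ≤ μ s)
    (hadd : ∀ s ∈ A, ∀ t ∈ A, Disjoint s t → μ (s ∪ t) = μ s + μ t) (Y : Set M)
    (F : Finset A) (E : Set M) (hE : E ∈ A) :
    ∃ ν : Set M → ℝ, (∀ s, 0 ≤ ν s) ∧ (∀ s t, Disjoint s t → ν (s ∪ t) = ν s + ν t) ∧
      (∀ s, ν s = ν (s ∩ E)) ∧ ν Set.univ = μ E ∧ (∀ D ∈ F, ν D = μ (D ∩ E)) ∧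
      ∃ G ∈ A, Y ∩ E ⊆ G ∧ G ⊆ E ∧ μ G ≤ ν Y := by
  classical
  have hμ0 : μ ∅ = 0 := by simpa using hadd ∅ hempty ∅ hempty (by simp)
  induction F using Finset.induction_on generalizing E with
  | empty =>
    rcases E.eq_empty_or_nonempty with rfl | hne
    · exact ⟨fun _ => 0, by simp, by simp, by simp, by simp [hμ0], by simp,
        ∅, hempty, by simp, by simp, by simp [hμ0]⟩
    · obtain ⟨x, hxE, hx⟩ : ∃ x ∈ E, (Y ∩ E).Nonempty → x ∈ Y := by
        by_cases h : (Y ∩ E).Nonempty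
        · obtain ⟨x, hxY, hxE⟩ := h
          exact ⟨x, hxE, fun _ => hxY⟩
        · exact ⟨hne.some, hne.some_mem, fun h' => absurd h' h⟩
      refine ⟨fun s => if x ∈ s then μ E else 0, fun s => ?_, fun s t hst => ?_, fun s => ?_,
        by simp, by simp, ?_⟩
      · dsimp only
        split_ifs
        exacts [hnonneg E hE, le_rfl]
      · have hx := fun hs : x ∈ s => Set.disjoint_left.1 hst hs
        by_cases h₁ : x ∈ s <;> by_cases h₂ : x ∈ t <;> simp_all
      · simp [hxE]
      · by_cases h : (Y ∩ E).Nonempty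
        · exact ⟨E, hE, Set.inter_subset_right, subset_rfl, by simp [hx h]⟩
        · refine ⟨∅, hempty, (Set.not_nonempty_iff_eq_empty.1 h).subset, by simp, ?_⟩
          have hxY : x ∉ Y := fun hxY => h ⟨x, hxY, hxE⟩
          simp [hxY, hμ0]
  | insert D F _ ih =>
    obtain ⟨ν₁, hn₁, ha₁, hs₁, hu₁, hF₁, G₁, hG₁, hYG₁, hGE₁, hμ₁⟩ :=
      ih (E ∩ D) (hinter _ hE _ D.2)
    obtain ⟨ν₂, hn₂, ha₂, hs₂, hu₂, hF₂, G₂, hG₂, hYG₂, hGE₂, hμ₂⟩ :=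
      ih (E \ D) (hdiff _ hE _ D.2)
    have hsplit : ∀ C ∈ A, μ (C ∩ (E ∩ D)) + μ (C ∩ (E \ D)) = μ (C ∩ E) := by
      intro C hC
      rw [← hadd _ (hinter _ hC _ (hinter _ hE _ D.2)) _ (hinter _ hC _ (hdiff _ hE _ D.2)),
        ← Set.inter_union_distrib_left, Set.inter_union_sdiff]
      exact Set.disjoint_left.2 fun x hx hx' => hx'.2.2 hx.2.2
    have hEsplit : μ (E ∩ D) + μ (E \ D) = μ E := by
      have := hsplit E hE
      simpa [← Set.inter_assoc, ← Set.inter_sdiff_assoc] using this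
    refine ⟨fun s => ν₁ s + ν₂ s, fun s => add_nonneg (hn₁ s) (hn₂ s), fun s t hst => ?_,
      fun s => ?_, ?_, fun C hC => ?_, G₁ ∪ G₂, hunion _ hG₁ _ hG₂, ?_, ?_, ?_⟩
    · simp only [ha₁ s t hst, ha₂ s t hst]
      ring
    · simp only
      rw [hs₁ s, hs₂ s, hs₁ (s ∩ E), hs₂ (s ∩ E)]
      congr 2 <;> (ext; simp only [Set.mem_inter_iff, Set.mem_sdiff]; tauto)
    · simp only [hu₁, hu₂, hEsplit]
    · rcases Finset.mem_insert.1 hC with rfl | hC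
      · have hν₁ : ν₁ C = μ (C ∩ E) := by
          have h₁ := ha₁ (E ∩ C) (E ∩ C)ᶜ disjoint_compl_right
          have h₂ : ν₁ (E ∩ C)ᶜ = ν₁ ∅ := by rw [hs₁]; simp
          have h₃ : ν₁ ∅ = 0 := by simpa using ha₁ ∅ ∅ (by simp)
          rw [Set.union_compl_self, hu₁, h₂, h₃, add_zero] at h₁
          rw [hs₁, Set.inter_comm (C : Set M) E, h₁]
          congr 1
          ext; simp only [Set.mem_inter_iff]; tauto
        have hν₂ : ν₂ C = 0 := by
          have h₃ : ν₂ ∅ = 0 := by simpa using ha₂ ∅ ∅ (by simp)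
          rw [hs₂, ← h₃]
          congr 1
          ext; simp only [Set.mem_inter_iff, Set.mem_sdiff, Set.mem_empty_iff_false]; tauto
        simp only [hν₁, hν₂, add_zero]
      · simp only [hF₁ C hC, hF₂ C hC, hsplit C C.2]
    · intro x hx
      by_cases hxD : x ∈ (D : Set M)
      · exact Or.inl (hYG₁ ⟨hx.1, hx.2, hxD⟩)
      · exact Or.inr (hYG₂ ⟨hx.1, hx.2, hxD⟩)
    · exact Set.union_subset (hGE₁.trans Set.inter_subset_left) (hGE₂.trans Set.sdiff_subset)
    · rw [hadd _ hG₁ _ hG₂ (Set.disjoint_left.2 fun x hx hx' => (hGE₂ hx').2 (hGE₁ hx).2)]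
      exact add_le_add hμ₁ hμ₂

/-- A set definable over the big model is approximated from outside, with respect to a measure
smooth over `P`, by sets definable over `P`. -/
theorem IsSmoothOver.exists_superset {L : FirstOrder.Language.{u, v}} {M : Type w} [L.Structure M]
    {P X : Set M} (hX : DefOver L M P X) {μ : Set M → ℝ} (hμ : IsSmoothOver L M P X μ)
    {Y : Set M} (hY : DefOver L M Set.univ Y) (hYX : Y ⊆ X) {ε : ℝ} (hε : 0 < ε) :
    ∃ G, DefOver L M P G ∧ G ⊆ X ∧ Y ⊆ G ∧ μ G < μ Y + ε := by
  obtain ⟨⟨hnonneg, hμX, hadd⟩, huniq⟩ := hμ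
  have hup : ∀ {s}, DefOver L M P s → DefOver L M Set.univ s := fun h => h.mono (Set.subset_univ _)
  let A : Set (Set M) := {s | DefOver L M P s ∧ s ⊆ X}
  have hXA : X ∈ A := ⟨hX, subset_rfl⟩
  choose ν hn ha hs hu hF G hG hYG _ hμG using fun F : Finset A =>
    exists_additive_agreeing_on_finset (A := A) (μ := μ)
      ⟨by simpa using hX.diff hX, Set.empty_subset _⟩
      (fun s hs t ht => ⟨hs.1.inter ht.1, Set.inter_subset_left.trans hs.2⟩)
      (fun s hs t ht => ⟨hs.1.diff ht.1, Set.sdiff_subset.trans hs.2⟩)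
      (fun s hs t ht => ⟨hs.1.union ht.1, Set.union_subset hs.2 ht.2⟩)
      (fun s hs => hnonneg s (hup hs.1) hs.2)
      (fun s hs t ht => hadd s t (hup hs.1) (hup ht.1) hs.2 ht.2) Y F X hXA
  have hle : ∀ F s, ν F s ≤ 1 := fun F s => by
    have := ha F s sᶜ disjoint_compl_right
    rw [Set.union_compl_self, hu, hμX] at this
    linarith [hn F sᶜ]
  let U : Ultrafilter (Finset A) := Ultrafilter.of atTop
  have hU : (U : Filter (Finset A)) ≤ atTop := Ultrafilter.of_le atTop
  obtain ⟨ν', -, hν'⟩ := (isCompact_univ_pi fun _ : Set M => isCompact_Icc (a := (0 : ℝ)) (b := 1))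
    |>.ultrafilter_le_nhds (U.map ν)
      (le_principal_iff.2 (mem_map.2 (Eventually.of_forall fun F s _ => ⟨hn F s, hle F s⟩)))
  have hlim : ∀ s, Tendsto (fun F => ν F s) U (𝓝 (ν' s)) := tendsto_pi_nhds.1 hν'
  have hagree : ∀ s, DefOver L M P s → s ⊆ X → ν' s = μ s := fun s hs hsX => by
    refine tendsto_nhds_unique (hlim s) (tendsto_const_nhds.congr' ?_)
    filter_upwards [hU (eventually_ge_atTop {(⟨s, hs, hsX⟩ : A)})] with F hsF
    rw [hF F ⟨s, hs, hsX⟩ (hsF (by simp)), Set.inter_eq_left.2 hsX]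
  have hν'Y : ν' Y = μ Y := by
    refine huniq ν' ⟨fun s _ _ => ?_, (hagree X hX subset_rfl).trans hμX, fun s t _ _ _ _ hst => ?_⟩
      hagree Y hY hYX
    · exact ge_of_tendsto' (hlim s) fun F => hn F s
    · refine tendsto_nhds_unique (hlim (s ∪ t)) (((hlim s).add (hlim t)).congr fun F => ?_)
      exact (ha F s t hst).symm
  obtain ⟨F, hFY⟩ := ((hlim Y).eventually_lt_const (show ν' Y < μ Y + ε by linarith)).exists
  refine ⟨G F, (hG F).1, (hG F).2, ?_, (hμG F).trans_lt hFY⟩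
  simpa [Set.inter_eq_left.2 hYX] using hYG F

theorem smooth_measure_domination
    {L : FirstOrder.Language.{u, v}} {M : Type w} [L.Structure M]
    (M₀ : L.ElementarySubstructure M)
    (X : Set M) (hX : DefOver L M (M₀ : Set M) X)
    (μ : Set M → ℝ) (hsmooth : IsSmoothOver L M (M₀ : Set M) X μ)
    (Y : Set M) (hY : DefOver L M Set.univ Y) (hYX : Y ⊆ X)
    (ε : ℝ) (hε : 0 < ε) :
    ∃ Z : Set M, DefOver L M (M₀ : Set M) Z ∧ Z ⊆ X ∧ μ Z < ε ∧
      ∀ p : Set (Set M), IsCompleteTypeOn L M (M₀ : Set M) X p → Z ∉ p →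
        (∃ D ∈ p, D ⊆ Y) ∨ (∃ D ∈ p, D ∩ Y = ∅) := by
  have hup : ∀ {s}, DefOver L M (M₀ : Set M) s → DefOver L M Set.univ s :=
    fun h => h.mono (Set.subset_univ _)
  obtain ⟨-, hμX, hadd⟩ := hsmooth.1
  have hYc : DefOver L M Set.univ (X \ Y) := (hup hX).diff hY
  obtain ⟨G, hG, hGX, hYG, hμG⟩ := hsmooth.exists_superset hX hY hYX (half_pos hε)
  obtain ⟨H, hH, hHX, hYH, hμH⟩ := hsmooth.exists_superset hX hYc Set.sdiff_subset (half_pos hε)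
  refine ⟨G ∩ H, hG.inter hH, Set.inter_subset_left.trans hGX, ?_, ?_⟩
  · have h₁ := hadd Y (X \ Y) hY hYc hYX Set.sdiff_subset Set.disjoint_sdiff_right
    have h₂ := hadd (G ∩ H) (G \ H) (hup (hG.inter hH)) (hup (hG.diff hH))
      (Set.inter_subset_left.trans hGX) (Set.sdiff_subset.trans hGX)
      (Set.disjoint_left.2 fun x hx hx' => hx'.2 hx.2)
    have h₃ := hadd H (G \ H) (hup hH) (hup (hG.diff hH)) hHX (Set.sdiff_subset.trans hGX)
      Set.disjoint_sdiff_right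
    have hHG : H ∪ G \ H = X := by
      refine (Set.union_subset hHX (Set.sdiff_subset.trans hGX)).antisymm fun x hx => ?_
      by_cases hxH : x ∈ H
      · exact Or.inl hxH
      · exact Or.inr ⟨hYG (by_contra fun hxY => hxH (hYH ⟨hx, hxY⟩)), hxH⟩
    rw [Set.union_sdiff_cancel hYX] at h₁
    rw [Set.inter_union_sdiff] at h₂
    rw [hHG] at h₃
    linarith
  · rintro p ⟨-, -, -, hinter, -, hdec⟩ hZ
    rcases hdec G hG hGX with hGp | hGp
    · rcases hdec H hH hHX with hHp | hHp
      · exact absurd (hinter G hGp H hHp) hZ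
      · exact Or.inl ⟨X \ H, hHp, fun x hx => by_contra fun hxY => hx.2 (hYH ⟨hx.1, hxY⟩)⟩
    · exact Or.inr ⟨X \ G, hGp, Set.eq_empty_of_forall_notMem fun x hx => hx.1.2 (hYG hx.2)⟩
end

section
/- Let M̄ be an L-structure whose theory is NIP and which is κ-saturated for some cardinal κ > |L| + ℵ₀. Let M₀ ≼ M̄ be an elementary substructure of cardinality less than κ, let V, W be M̄-definable sets and R ⊆ V × W a relation, all definable with parameters from M₀. Let μ be a Keisler measure on V over M̄ which is definable over M₀ and finitely satisfiable in M₀. Then for every ε > 0 there are a finite partition W = W₁ ∪ … ∪ W_m into sets definable with parameters from M₀ and, for each j ≤ m, a finite partition V = Z_j ∪ V_{j,1} ∪ … ∪ V_{j,n_j} into sets definable with parameters from M₀ such that μ(Z_j) < ε and, for each i ≤ n_j: either μ(V_{j,i} ∩ R_b) < ε·μ(V_{j,i}) for all b ∈ W_j, or μ(V_{j,i} ∖ R_b) < ε·μ(V_{j,i}) for all b ∈ W_j, where R_b = {a ∈ V : (a,b) ∈ R}. -/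
/-!
STATEMENT 8: The intermediate partition step in the regularity theorem for
generically stable measures in NIP theories.  If `Th(M̄)` is NIP, `M̄` is
`κ`-saturated with `κ > |L| + ℵ₀`, `M₀ ≼ M̄` has cardinality `< κ`, `V`, `W`, `R`
are definable over `M₀`, and `μ` is a Keisler measure on `V` over `M̄` definable over
and finitely satisfiable in `M₀`, then for every `ε > 0` there is a finite
`M₀`-definable partition `W = W₁ ∪ … ∪ W_m` and, for each `j`, a finite
`M₀`-definable partition `V = Z_j ∪ V_{j,1} ∪ … ∪ V_{j,n_j}` with `μ(Z_j) < ε` such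
that each `V_{j,i}` is `ε`-homogeneous (in `μ`-measure) with respect to all fibers
`R_b`, `b ∈ W_j`.
-/

open FirstOrder

universe u v w

/-- `r : M → M → Prop` is definable with parameters from `P`. -/
def DefRelOver (L : FirstOrder.Language.{u, v}) (M : Type w) [L.Structure M]
    (P : Set M) (r : M → M → Prop) : Prop :=
  ∃ (k : ℕ) (φ : L.Formula ((Unit ⊕ Unit) ⊕ Fin k)) (c : Fin k → M),
    (∀ j, c j ∈ P) ∧
    ∀ a b, r a b ↔ φ.Realize (Sum.elim (Sum.elim (fun _ => a) (fun _ => b)) c)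

/-- A subset of the `m`-tuple sort of `M`, definable with parameters from `P`. -/
def DefTupleOver (L : FirstOrder.Language.{u, v}) (M : Type w) [L.Structure M]
    (P : Set M) (m : ℕ) (s : Set (Fin m → M)) : Prop :=
  ∃ (k : ℕ) (φ : L.Formula (Fin m ⊕ Fin k)) (c : Fin k → M),
    (∀ j, c j ∈ P) ∧ s = {b | φ.Realize (Sum.elim b c)}

/-- The formula `φ(x, y)` is NIP in `M`. -/
def FormulaIsNIPIn (L : FirstOrder.Language.{u, v}) (M : Type w) [L.Structure M]
    {α β : Type} (φ : L.Formula (α ⊕ β)) : Prop :=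
  ∃ k : ℕ, ¬∃ (b : Fin k → β → M) (a : Set (Fin k) → α → M),
    ∀ (S : Set (Fin k)) (i : Fin k), φ.Realize (Sum.elim (a S) (b i)) ↔ i ∈ S

/-- The theory of `M` is NIP. -/
def TheoryIsNIP (L : FirstOrder.Language.{u, v}) (M : Type w) [L.Structure M] : Prop :=
  ∀ (n m : ℕ) (φ : L.Formula (Fin n ⊕ Fin m)), FormulaIsNIPIn L M φ

/-- `M` is `κ`-saturated. -/
def IsKappaSaturated (L : FirstOrder.Language.{u, v}) (M : Type w) [L.Structure M]
    (κ : Cardinal.{w}) : Prop :=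
  ∀ P : Set M, Cardinal.mk P < κ →
    ∀ T : Set ((k : ℕ) × (L.Formula (Unit ⊕ Fin k) × (Fin k → M))),
      (∀ t ∈ T, ∀ j, t.2.2 j ∈ P) →
      (∀ T₀ ⊆ T, T₀.Finite →
        ∃ a : M, ∀ t ∈ T₀, t.2.1.Realize (Sum.elim (fun _ => a) t.2.2)) →
      ∃ a : M, ∀ t ∈ T, t.2.1.Realize (Sum.elim (fun _ => a) t.2.2)

/-- The Keisler measure `μ` on `V` is definable over the parameter set `P`. -/
def MeasureDefOver (L : FirstOrder.Language.{u, v}) (M : Type w) [L.Structure M]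
    (P : Set M) (V : Set M) (μ : Set M → ℝ) : Prop :=
  ∀ (m : ℕ) (φ : L.Formula (Unit ⊕ Fin m)) (ε : ℝ), 0 < ε →
    ∃ (r : ℕ) (B : Fin r → Set (Fin m → M)),
      (∀ t, DefTupleOver L M P m (B t)) ∧
      (⋃ t, B t) = Set.univ ∧ Pairwise (Function.onFun Disjoint B) ∧
      ∀ t, ∀ b ∈ B t, ∀ b' ∈ B t,
        |μ (V ∩ {a | φ.Realize (Sum.elim (fun _ => a) b)}) -
            μ (V ∩ {a | φ.Realize (Sum.elim (fun _ => a) b')})| ≤ ε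

/-- `μ` is finitely satisfiable in `P`. -/
def MeasureFinSatIn (L : FirstOrder.Language.{u, v}) (M : Type w) [L.Structure M]
    (P : Set M) (V : Set M) (μ : Set M → ℝ) : Prop :=
  ∀ s, DefOver L M Set.univ s → s ⊆ V → 0 < μ s → ∃ a ∈ s, a ∈ P

open Finset in
/-- A relation without shattered `k`-element sets cuts out polynomially many traces on an
`m`-element set. -/
theorem card_le_of_not_shattered {α : Type*} {β : Type*} (r : α → β → Prop) (k : ℕ)
    (h : ¬∃ (x : Fin k → α) (y : Set (Fin k) → β), ∀ S i, r (x i) (y S) ↔ i ∈ S)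
    {m N : ℕ} (x : Fin m → α) (y : Fin N → β)
    (hsep : ∀ i j, i ≠ j → ∃ l, ¬(r (x l) (y i) ↔ r (x l) (y j))) :
    N ≤ (k + 1) * (m + 1) ^ k := by
  classical
  let trace : Fin N → Finset (Fin m) := fun j => univ.filter fun l => r (x l) (y j)
  have htrace : Function.Injective trace := by
    intro i j hij
    by_contra hne
    obtain ⟨l, hl⟩ := hsep i j hne
    apply hl
    have := congrArg (l ∈ ·) hij
    simpa [trace] using this
  let A : Finset (Finset (Fin m)) := univ.image trace
  have hcard : #A = N := by
    rw [card_image_of_injective _ htrace, card_univ, Fintype.card_fin]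
  have hdim : A.vcDim ≤ k := by
    refine Finset.sup_le fun s hs => ?_
    rw [mem_shatterer] at hs
    by_contra hk
    obtain ⟨t, hts, htk⟩ := exists_subset_card_eq (le_of_not_ge hk)
    replace hs := hs.mono_right hts
    let e : Fin k ≃ t := (t.equivFinOfCardEq htk).symm
    apply h
    have key : ∀ S : Set (Fin k), ∃ b : β, ∀ i, r (x (e i)) b ↔ i ∈ S := by
      intro S
      obtain ⟨u, hu, hut⟩ := hs (t := t.filter fun l => ∃ i ∈ S, (e i : Fin m) = l)
        (filter_subset _ _)
      obtain ⟨j, -, rfl⟩ := mem_image.1 hu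
      refine ⟨y j, fun i => ?_⟩
      have := congrArg ((e i : Fin m) ∈ ·) hut
      simpa [trace] using this
    choose b hb using key
    exact ⟨fun i => x (e i), b, hb⟩
  calc N = #A := hcard.symm
    _ ≤ #A.shatterer := A.card_le_card_shatterer
    _ ≤ ∑ i ∈ Iic A.vcDim, (Fintype.card (Fin m)).choose i := card_shatterer_le_sum_vcDim
    _ ≤ ∑ i ∈ Iic k, (Fintype.card (Fin m)).choose i :=
        sum_le_sum_of_subset (Iic_subset_Iic.2 hdim)
    _ ≤ ∑ i ∈ Iic k, (m + 1) ^ k := by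
        refine sum_le_sum fun i hi => ?_
        rw [Fintype.card_fin]
        calc m.choose i ≤ m ^ i := Nat.choose_le_pow m i
          _ ≤ (m + 1) ^ i := Nat.pow_le_pow_left m.le_succ i
          _ ≤ (m + 1) ^ k := Nat.pow_le_pow_right m.succ_pos (mem_Iic.1 hi)
    _ = (k + 1) * (m + 1) ^ k := by simp

/-- If pairwise non-close families have bounded size, then every set contains a finite net of
itself. -/
theorem exists_finset_net {α : Type*} {Close : α → α → Prop}
    (hsymm : ∀ a b, Close a b → Close b a) (C : Set α) {N : ℕ}
    (hN : ∀ y : Fin N → α, ∃ i j, i ≠ j ∧ Close (y i) (y j)) :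
    ∃ s : Finset α, (∀ a ∈ s, a ∈ C) ∧ ∀ c ∈ C, ∃ a ∈ s, Close c a := by
  classical
  by_contra! hcon
  have grow : ∀ n : ℕ, ∃ y : Fin n → α,
      (∀ i, y i ∈ C) ∧ ∀ i j, i ≠ j → ¬Close (y i) (y j) := by
    intro n
    induction n with
    | zero => exact ⟨Fin.elim0, fun i => i.elim0, fun i => i.elim0⟩
    | succ n ih =>
      obtain ⟨y, hyC, hy⟩ := ih
      obtain ⟨c, hc, hfar⟩ := hcon (Finset.univ.image y) (by simpa using hyC)
      have hfar' : ∀ i, ¬Close c (y i) := fun i => hfar _ (by simp)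
      refine ⟨Fin.cons c y, fun i => ?_, fun i j hij => ?_⟩
      · cases i using Fin.cases with
        | zero => simpa using hc
        | succ i => simpa using hyC i
      · cases i using Fin.cases with
        | zero =>
          cases j using Fin.cases with
          | zero => exact absurd rfl hij
          | succ j => simpa using hfar' j
        | succ i =>
          cases j using Fin.cases with
          | zero => simpa using fun hcl => hfar' i (hsymm _ _ hcl)
          | succ j => simpa using hy i j fun e => hij (by rw [e])
  obtain ⟨y, -, hy⟩ := grow N
  obtain ⟨i, j, hij, hcl⟩ := hN y
  exact hy i j hij hcl

/-- The square of a polynomial in `m` is eventually beaten by the decay of `(1 - δ) ^ m`. -/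
theorem exists_sq_mul_pow_lt_one (k : ℕ) {δ : ℝ} (hδ : 0 < δ) (hδ1 : δ ≤ 1) :
    ∃ m : ℕ, ((((k + 1) * (m + 1) ^ k + 1 : ℕ) : ℝ)) ^ 2 * (1 - δ) ^ m < 1 := by
  have habs : |1 - δ| < 1 := by rw [abs_lt]; constructor <;> linarith
  have hlim := (tendsto_pow_const_mul_const_pow_of_abs_lt_one (2 * k) habs).const_mul
    (((k : ℝ) + 2) ^ 2 * 2 ^ (2 * k))
  rw [mul_zero] at hlim
  obtain ⟨m, hm, hm1⟩ :=
    ((hlim.eventually (gt_mem_nhds one_pos)).and (Filter.eventually_ge_atTop 1)).exists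
  refine ⟨m, lt_of_le_of_lt ?_ hm⟩
  have hm1' : (1 : ℝ) ≤ m := by exact_mod_cast hm1
  have hpow : 0 ≤ (1 - δ) ^ m := pow_nonneg (by linarith) m
  have hbase : (((k + 1) * (m + 1) ^ k + 1 : ℕ) : ℝ) ≤ (k + 2) * (2 * m) ^ k := by
    push_cast
    have h1 : ((m : ℝ) + 1) ^ k ≤ (2 * m) ^ k := by gcongr; linarith
    have h2 : (1 : ℝ) ≤ (2 * m) ^ k := one_le_pow₀ (by linarith)
    nlinarith [(Nat.cast_nonneg k : (0 : ℝ) ≤ k)]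
  calc _ ≤ ((k + 2) * (2 * (m : ℝ)) ^ k) ^ 2 * (1 - δ) ^ m := by gcongr
    _ = _ := by rw [mul_pow, mul_pow, mul_pow]; ring

section Definability

variable {L : FirstOrder.Language.{u, v}} {M : Type w} [L.Structure M] {P : Set M}

theorem DefOver.mono_s8 {Q s : Set M} (hs : DefOver L M P s) (hPQ : P ⊆ Q) : DefOver L M Q s := by
  obtain ⟨k, φ, c, hc, rfl⟩ := hs
  exact ⟨k, φ, c, fun j => hPQ (hc j), rfl⟩

theorem DefOver.compl_s8 {s : Set M} (hs : DefOver L M P s) : DefOver L M P sᶜ := by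
  obtain ⟨k, φ, c, hc, rfl⟩ := hs
  exact ⟨k, φ.not, c, hc, by ext; simp⟩

theorem DefOver.inter_s8 {s t : Set M} (hs : DefOver L M P s) (ht : DefOver L M P t) :
    DefOver L M P (s ∩ t) := by
  obtain ⟨k, φ, c, hc, rfl⟩ := hs
  obtain ⟨l, ψ, d, hd, rfl⟩ := ht
  refine ⟨k + l, φ.relabel (Sum.map id (Fin.castAdd l)) ⊓ ψ.relabel (Sum.map id (Fin.natAdd k)),
    Fin.append c d, fun j => ?_, ?_⟩
  · cases j using Fin.addCases with
    | left j => simpa using hc j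
    | right j => simpa using hd j
  · ext a
    simp only [Set.mem_inter_iff, Set.mem_ofPred_eq, Language.Formula.realize_inf,
      Language.Formula.realize_relabel]
    apply iff_of_eq
    congr 3 <;> ext (_ | _) <;> simp

theorem DefOver.diff_s8 {s t : Set M} (hs : DefOver L M P s) (ht : DefOver L M P t) :
    DefOver L M P (s \ t) :=
  hs.inter_s8 ht.compl_s8

theorem defOver_univ : DefOver L M P Set.univ :=
  ⟨0, ⊤, Fin.elim0, fun j => j.elim0, by ext; simp⟩

theorem defOver_empty : DefOver L M P ∅ := by
  simpa using (defOver_univ (L := L) (P := P)).compl_s8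

theorem DefOver.iInter_fintype {ι : Type*} [Finite ι] {s : ι → Set M}
    (hs : ∀ i, DefOver L M P (s i)) : DefOver L M P (⋂ i, s i) := by
  have key : ∀ F : Set ι, F.Finite → DefOver L M P (⋂ i ∈ F, s i) := by
    intro F hF
    induction F, hF using Set.Finite.induction_on with
    | empty => simpa using defOver_univ
    | insert _ _ ih => rw [Set.biInter_insert]; exact (hs _).inter_s8 ih
  simpa using key Set.univ Set.finite_univ

theorem DefRelOver.defOver_left {r : M → M → Prop} (hr : DefRelOver L M P r) {b : M}
    (hb : b ∈ P) : DefOver L M P {a | r a b} := by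
  obtain ⟨k, φ, c, hc, h⟩ := hr
  refine ⟨k + 1, φ.relabel (Sum.elim (Sum.elim Sum.inl fun _ => Sum.inr 0)
    fun j => Sum.inr j.succ), Fin.cons b c, fun j => ?_, ?_⟩
  · cases j using Fin.cases with
    | zero => simpa using hb
    | succ j => simpa using hc j
  · ext a
    simp only [Set.mem_ofPred_eq, h, Language.Formula.realize_relabel]
    apply iff_of_eq
    congr 1
    ext ((_ | _) | _) <;> simp

theorem DefRelOver.mono_s8 {Q : Set M} {r : M → M → Prop} (hr : DefRelOver L M P r) (hPQ : P ⊆ Q) :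
    DefRelOver L M Q r := by
  obtain ⟨k, φ, c, hc, h⟩ := hr
  exact ⟨k, φ, c, fun j => hPQ (hc j), h⟩

/-- Tuple-definable sets have definable fibres over parameters. -/
theorem DefTupleOver.defOver_cons {n : ℕ} {s : Set (Fin (n + 1) → M)}
    (hs : DefTupleOver L M P (n + 1) s) {d : Fin n → M} (hd : ∀ j, d j ∈ P) :
    DefOver L M P {b | (Fin.cons b d : Fin (n + 1) → M) ∈ s} := by
  obtain ⟨k, φ, c, hc, rfl⟩ := hs
  refine ⟨n + k, φ.relabel (Sum.elim
    (Fin.cases (Sum.inl ()) fun j => Sum.inr (Fin.castAdd k j))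
    fun j => Sum.inr (Fin.natAdd n j)), Fin.append d c, fun j => ?_, ?_⟩
  · cases j using Fin.addCases with
    | left j => simpa using hd j
    | right j => simpa using hc j
  · ext a
    simp only [Set.mem_ofPred_eq, Language.Formula.realize_relabel]
    apply iff_of_eq
    congr 1
    ext (j | j)
    · cases j using Fin.cases <;> simp
    · simp

/-- A nonempty set definable over an elementary substructure meets that substructure. -/
theorem DefOver.exists_mem_of_nonempty {M₀ : L.ElementarySubstructure M} {s : Set M}
    (hs : DefOver L M (M₀ : Set M) s) (hne : s.Nonempty) : ∃ a ∈ s, a ∈ M₀ := by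
  obtain ⟨k, φ, c, hc, rfl⟩ := hs
  obtain ⟨a, ha⟩ := hne
  let c₀ : Fin k → M₀ := fun j => ⟨c j, hc j⟩
  let ψ : L.Formula (Fin k) := (φ.relabel Sum.swap).iExs Unit
  have hψ : ψ.Realize (M₀.subtype ∘ c₀) := by
    rw [Language.Formula.realize_iExs]
    refine ⟨fun _ => a, ?_⟩
    rw [Language.Formula.realize_relabel]
    convert (show φ.Realize (Sum.elim (fun _ => a) c) from ha) using 1
    ext (_ | _) <;> rfl
  rw [M₀.subtype.map_formula, Language.Formula.realize_iExs] at hψ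
  obtain ⟨e, he⟩ := hψ
  rw [Language.Formula.realize_relabel, ← M₀.subtype.map_formula] at he
  refine ⟨e (), ?_, (e ()).2⟩
  show φ.Realize _
  convert he using 1
  ext (_ | _) <;> rfl

end Definability

section Measure

variable {L : FirstOrder.Language.{u, v}} {M : Type w} [L.Structure M] {V : Set M}
  {μ : Set M → ℝ}

theorem IsKeislerMeasureOn.empty (hμ : IsKeislerMeasureOn L M V μ) : μ ∅ = 0 := by
  have := hμ.2.2 ∅ ∅ defOver_empty defOver_empty (Set.empty_subset _) (Set.empty_subset _)
    (Set.disjoint_empty _)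
  rw [Set.union_empty] at this
  linarith

theorem IsKeislerMeasureOn.inter_add_diff (hμ : IsKeislerMeasureOn L M V μ) {s t : Set M}
    (hs : DefOver L M Set.univ s) (ht : DefOver L M Set.univ t) (hsV : s ⊆ V) :
    μ (s ∩ t) + μ (s \ t) = μ s := by
  rw [← hμ.2.2 _ _ (hs.inter_s8 ht) (hs.diff_s8 ht) (Set.inter_subset_left.trans hsV)
    (Set.sdiff_subset.trans hsV) Set.disjoint_sdiff_inter.symm, Set.inter_union_sdiff]

theorem IsKeislerMeasureOn.mono_s8 (hμ : IsKeislerMeasureOn L M V μ) {s t : Set M}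
    (hs : DefOver L M Set.univ s) (ht : DefOver L M Set.univ t) (hst : s ⊆ t) (htV : t ⊆ V) :
    μ s ≤ μ t := by
  have h := hμ.inter_add_diff ht hs htV
  rw [Set.inter_eq_right.2 hst] at h
  linarith [hμ.1 _ (ht.diff_s8 hs) (Set.sdiff_subset.trans htV)]

open Finset in
open scoped Classical in
/-- If every point lies in at most `c` of the sets `S p`, their measures sum to at most `c`. -/
theorem IsKeislerMeasureOn.sum_le (hμ : IsKeislerMeasureOn L M V μ) {ι : Type*} (P : Finset ι)
    {S : ι → Set M} (hS : ∀ p, DefOver L M Set.univ (S p)) :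
    ∀ {U : Set M}, DefOver L M Set.univ U → U ⊆ V → ∀ c : ℝ,
      (∀ x ∈ U, (#{p ∈ P | x ∈ S p} : ℝ) ≤ c) → ∑ p ∈ P, μ (U ∩ S p) ≤ c * μ U := by
  induction P using Finset.induction_on with
  | empty =>
    intro U hU hUV c hc
    rcases U.eq_empty_or_nonempty with rfl | ⟨x, hx⟩
    · simp [hμ.empty]
    · have : 0 ≤ c := by simpa using hc x hx
      simpa using mul_nonneg this (hμ.1 U hU hUV)
  | insert p P hp ih =>
    intro U hU hUV c hc
    have hin := ih (hU.inter_s8 (hS p)) (Set.inter_subset_left.trans hUV) (c - 1) fun x hx => by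
      have := hc x hx.1
      rw [filter_insert, if_pos hx.2, card_insert_of_notMem (by simp [hp])] at this
      push_cast at this
      linarith
    have hout := ih (hU.diff_s8 (hS p)) (Set.sdiff_subset.trans hUV) c fun x hx => by
      have := hc x hx.1
      rwa [filter_insert, if_neg hx.2] at this
    have hsplit : ∀ q ∈ P, μ (U ∩ S q) = μ (U ∩ S p ∩ S q) + μ (U \ S p ∩ S q) := fun q _ => by
      rw [← hμ.inter_add_diff (hU.inter_s8 (hS q)) (hS p) (Set.inter_subset_left.trans hUV)]
      congr 2 <;> (ext; simp; tauto)
    rw [sum_insert hp, sum_congr rfl hsplit, sum_add_distrib]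
    rw [← hμ.inter_add_diff hU (hS p) hUV]
    linarith

open Finset in
open scoped Classical in
/-- Some point lies in a proportion at least `δ` of any finite family of sets of measure `≥ δ`. -/
theorem IsKeislerMeasureOn.exists_mem_many (hμ : IsKeislerMeasureOn L M V μ)
    (hV : DefOver L M Set.univ V) {ι : Type*} (P : Finset ι) {S : ι → Set M}
    (hS : ∀ p, DefOver L M Set.univ (S p)) {δ : ℝ} (hδ : ∀ p ∈ P, δ ≤ μ (V ∩ S p)) :
    ∃ x, δ * #P ≤ #{p ∈ P | x ∈ S p} := by
  by_contra! hcon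
  have hle := hμ.sum_le P hS hV subset_rfl ((⌈δ * #P⌉ : ℝ) - 1) fun x _ => by
    have h : (#{p ∈ P | x ∈ S p} : ℤ) < ⌈δ * #P⌉ := Int.lt_ceil.2 (by exact_mod_cast hcon x)
    have h' : (#{p ∈ P | x ∈ S p} : ℤ) ≤ ⌈δ * #P⌉ - 1 := by omega
    exact_mod_cast h'
  have hge : #P • δ ≤ ∑ p ∈ P, μ (V ∩ S p) := card_nsmul_le_sum _ _ _ hδ
  rw [nsmul_eq_mul] at hge
  rw [hμ.2.1] at hle
  linarith [Int.ceil_lt_add_one (δ * #P)]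

open Finset in
open scoped Classical in
/-- Greedy choice of `m` points missing only a proportion `(1 - δ) ^ m` of the sets `S p`. -/
theorem IsKeislerMeasureOn.exists_hitting (hμ : IsKeislerMeasureOn L M V μ)
    (hV : DefOver L M Set.univ V) {ι : Type*} (P : Finset ι) {S : ι → Set M}
    (hS : ∀ p, DefOver L M Set.univ (S p)) {δ : ℝ} (hδ1 : δ ≤ 1)
    (hδ : ∀ p ∈ P, δ ≤ μ (V ∩ S p)) (m : ℕ) :
    ∃ x : Fin m → M, (#{p ∈ P | ∀ l, x l ∉ S p} : ℝ) ≤ (1 - δ) ^ m * #P := by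
  induction m with
  | zero => exact ⟨Fin.elim0, by simp⟩
  | succ m ih =>
    obtain ⟨x, hx⟩ := ih
    obtain ⟨a, ha⟩ := hμ.exists_mem_many hV {p ∈ P | ∀ l, x l ∉ S p} hS
      fun p hp => hδ p (mem_filter.1 hp).1
    refine ⟨Fin.cons a x, ?_⟩
    have hsplit := card_filter_add_card_filter_not (s := {p ∈ P | ∀ l, x l ∉ S p})
      (fun p => a ∈ S p)
    have hset : ({p ∈ P | ∀ l, (Fin.cons a x : Fin (m + 1) → M) l ∉ S p} : Finset ι) =
        {p ∈ {p ∈ P | ∀ l, x l ∉ S p} | a ∉ S p} := by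
      ext p
      simp [Fin.forall_fin_succ]
      tauto
    rw [hset]
    have hsplit' := congrArg (Nat.cast : ℕ → ℝ) hsplit
    push_cast at hsplit'
    have := mul_le_mul_of_nonneg_left hx (sub_nonneg.2 hδ1)
    rw [pow_succ]
    linarith

open Finset in
/-- A relation without shattered `k`-element sets has only boundedly many fibres that are
pairwise `δ`-separated in measure. -/
theorem IsKeislerMeasureOn.exists_packing_bound (hμ : IsKeislerMeasureOn L M V μ)
    (hV : DefOver L M Set.univ V) {r : M → M → Prop}
    (hr : ∀ b c, DefOver L M Set.univ {a | ¬(r a b ↔ r a c)}) {k : ℕ}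
    (h : ¬∃ (x : Fin k → M) (y : Set (Fin k) → M), ∀ S i, r (x i) (y S) ↔ i ∈ S)
    {δ : ℝ} (hδ : 0 < δ) (hδ1 : δ ≤ 1) :
    ∃ N : ℕ, ∀ y : Fin N → M, ∃ i j, i ≠ j ∧ μ (V ∩ {a | ¬(r a (y i) ↔ r a (y j))}) < δ := by
  classical
  obtain ⟨m, hm⟩ := exists_sq_mul_pow_lt_one k hδ hδ1
  obtain ⟨N, hN⟩ : ∃ N, N = (k + 1) * (m + 1) ^ k + 1 := ⟨_, rfl⟩
  rw [← hN] at hm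
  refine ⟨N, fun y => ?_⟩
  by_contra hcon
  replace hcon : ∀ i j, i ≠ j → δ ≤ μ (V ∩ {a | ¬(r a (y i) ↔ r a (y j))}) :=
    fun i j hij => not_lt.1 fun hlt => hcon ⟨i, j, hij, hlt⟩
  obtain ⟨S, hS⟩ : ∃ S : Fin N × Fin N → Set M, ∀ p, S p = {a | ¬(r a (y p.1) ↔ r a (y p.2))} :=
    ⟨_, fun _ => rfl⟩
  obtain ⟨x, hx⟩ := hμ.exists_hitting hV (univ : Finset (Fin N)).offDiag
    (fun p => hS p ▸ hr _ _) hδ1 (fun p hp => hS p ▸ hcon p.1 p.2 (mem_offDiag.1 hp).2.2) m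
  have hcard : (#(univ : Finset (Fin N)).offDiag : ℝ) ≤ (N : ℝ) ^ 2 := by
    have : #(univ : Finset (Fin N)).offDiag ≤ N ^ 2 := by
      rw [offDiag_card, card_univ, Fintype.card_fin, sq]
      exact Nat.sub_le _ _
    exact_mod_cast this
  have hlt := (hx.trans
    (mul_le_mul_of_nonneg_left hcard (pow_nonneg (sub_nonneg.2 hδ1) m))).trans_lt
    ((mul_comm _ _).trans_lt hm)
  have hnone := card_eq_zero.1 (Nat.cast_lt_one.1 hlt)
  have := card_le_of_not_shattered r k h x y fun i j hij => by
    have hmem := eq_empty_iff_forall_notMem.1 hnone (i, j)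
    rw [mem_filter, not_and] at hmem
    simpa only [hS, Set.mem_ofPred_eq, not_forall, not_not] using hmem (by simpa using hij)
  omega

end Measure

theorem DefRelOver.defOver_not_iff {L : FirstOrder.Language.{u, v}} {M : Type w} [L.Structure M]
    {P : Set M} {r : M → M → Prop} (hr : DefRelOver L M P r) {b c : M} (hb : b ∈ P)
    (hc : c ∈ P) : DefOver L M P {a | ¬(r a b ↔ r a c)} := by
  have hb' := hr.defOver_left hb
  have hc' := hr.defOver_left hc
  convert ((hb'.diff_s8 hc').compl_s8.inter_s8 (hc'.diff_s8 hb').compl_s8).compl_s8 using 1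
  ext a
  simp
  tauto

/-- In a NIP structure, no definable relation shatters arbitrarily large finite sets. -/
theorem TheoryIsNIP.exists_not_shattered {L : FirstOrder.Language.{u, v}} {M : Type w}
    [L.Structure M] (hNIP : TheoryIsNIP L M) {P : Set M} {r : M → M → Prop}
    (hr : DefRelOver L M P r) :
    ∃ k : ℕ, ¬∃ (x : Fin k → M) (y : Set (Fin k) → M), ∀ S i, r (x i) (y S) ↔ i ∈ S := by
  obtain ⟨l, φ, c, -, hφ⟩ := hr
  obtain ⟨k, hk⟩ := hNIP (l + 1) 1 (φ.relabel (Sum.elim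
    (Sum.elim (fun _ => Sum.inr 0) fun _ => Sum.inl 0) fun j => Sum.inl j.succ))
  refine ⟨k, fun ⟨x, y, hxy⟩ => hk ⟨fun i _ => x i, fun S => Fin.cons (y S) c, fun S i => ?_⟩⟩
  rw [← hxy S i, hφ, Language.Formula.realize_relabel]
  apply iff_of_eq
  congr 1
  ext ((_ | _) | _) <;> simp

/-- For a measure definable over `P`, the parameter pairs of a relation definable over `P` can be
partitioned into finitely many pieces, with `P`-definable fibres, on which the measure of the
difference of the two fibres of the relation is almost constant. -/
theorem MeasureDefOver.exists_partition_not_iff {L : FirstOrder.Language.{u, v}} {M : Type w}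
    [L.Structure M] {P V : Set M} {μ : Set M → ℝ} (hdef : MeasureDefOver L M P V μ)
    {r : M → M → Prop} (hr : DefRelOver L M P r) {η : ℝ} (hη : 0 < η) :
    ∃ (q : ℕ) (B : Fin q → M → Set M),
      (∀ t, ∀ c ∈ P, DefOver L M P (B t c)) ∧ (∀ c, (⋃ t, B t c) = Set.univ) ∧
      (∀ c, Pairwise (Function.onFun Disjoint fun t => B t c)) ∧
      ∀ t c, ∀ b ∈ B t c, ∀ b' ∈ B t c,
        |μ (V ∩ {a | ¬(r a b ↔ r a c)}) - μ (V ∩ {a | ¬(r a b' ↔ r a c)})| ≤ η := by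
  obtain ⟨l, φ, d, hd, hφ⟩ := hr
  let ψ : L.Formula (Unit ⊕ Fin (l + 1 + 1)) :=
    ((φ.relabel (Sum.elim (Sum.elim Sum.inl fun _ => Sum.inr 0)
        fun j => Sum.inr j.succ.succ)).iff
      (φ.relabel (Sum.elim (Sum.elim Sum.inl fun _ => Sum.inr (Fin.succ 0))
        fun j => Sum.inr j.succ.succ))).not
  let tuple : M → M → Fin (l + 1 + 1) → M := fun b c => Fin.cons b (Fin.cons c d)
  have hψ : ∀ b c, {a | ψ.Realize (Sum.elim (fun _ => a) (tuple b c))} =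
      {a | ¬(r a b ↔ r a c)} := by
    intro b c
    ext a
    simp only [ψ, Set.mem_ofPred_eq, Language.Formula.realize_not,
      Language.Formula.realize_iff, Language.Formula.realize_relabel, hφ]
    apply iff_of_eq
    congr 3 <;> ext ((_ | _) | _) <;> simp [tuple]
  obtain ⟨q, B, hB, hcover, hdisj, happrox⟩ := hdef _ ψ η hη
  refine ⟨q, fun t c => {b | tuple b c ∈ B t}, fun t c hc => ?_, fun c => ?_,
    fun c t t' htt' => ?_, fun t c b hb b' hb' => ?_⟩
  · refine (hB t).defOver_cons fun j => ?_
    cases j using Fin.cases with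
    | zero => simpa using hc
    | succ j => simpa using hd j
  · refine Set.eq_univ_of_forall fun b => ?_
    have : tuple b c ∈ ⋃ t, B t := hcover ▸ Set.mem_univ _
    simpa using this
  · exact Set.disjoint_left.2 fun b hb hb' => Set.disjoint_left.1 (hdisj htt') hb hb'
  · simpa only [hψ] using happrox t _ hb _ hb'

/-- If all fibres over `U` are close to a fixed definable set `A`, then after discarding the small
ones among `A` and `V \ A` these sets are homogeneous. -/
theorem IsKeislerMeasureOn.exists_homogeneous_partition {L : FirstOrder.Language.{u, v}}
    {M : Type w} [L.Structure M] {P V : Set M} {μ : Set M → ℝ} (hμ : IsKeislerMeasureOn L M V μ)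
    (hV : DefOver L M P V) {A : Set M} (hA : DefOver L M P A) (hAV : A ⊆ V) {R : M → M → Prop}
    {U : Set M} {ε : ℝ} (hε : 0 < ε) (hε1 : ε ≤ 1)
    (hU : ∀ b ∈ U, μ (A \ {a | R a b}) < ε * (ε / 2) ∧
      μ ((V \ A) ∩ {a | R a b}) < ε * (ε / 2)) :
    ∃ (n : ℕ) (Z : Set M) (Vp : Fin n → Set M),
      DefOver L M P Z ∧ (∀ i, DefOver L M P (Vp i)) ∧
      Z ∪ (⋃ i, Vp i) = V ∧ Pairwise (Function.onFun Disjoint Vp) ∧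
      (∀ i, Disjoint Z (Vp i)) ∧
      μ Z < ε ∧
      ∀ i : Fin n,
        (∀ b ∈ U, μ (Vp i ∩ {a | R a b}) < ε * μ (Vp i)) ∨
        (∀ b ∈ U, μ (Vp i \ {a | R a b}) < ε * μ (Vp i)) := by
  have hsum := hμ.inter_add_diff (hV.mono_s8 (Set.subset_univ _)) (hA.mono_s8 (Set.subset_univ _))
    subset_rfl
  rw [Set.inter_eq_right.2 hAV, hμ.2.1] at hsum
  have hbig : ∀ s, ε / 2 ≤ μ s → ε * (ε / 2) ≤ ε * μ s := fun s hs =>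
    mul_le_mul_of_nonneg_left hs hε.le
  rcases lt_or_ge (μ A) (ε / 2) with hA2 | hA2
  · refine ⟨1, A, fun _ => V \ A, hA, fun _ => hV.diff_s8 hA, ?_, Subsingleton.pairwise,
      fun _ => Set.disjoint_sdiff_right, by linarith, fun _ => Or.inl fun b hb => ?_⟩
    · rw [Set.iUnion_const, Set.union_sdiff_cancel hAV]
    · exact (hU b hb).2.trans_le (hbig _ (by linarith))
  · rcases lt_or_ge (μ (V \ A)) (ε / 2) with hB2 | hB2
    · refine ⟨1, V \ A, fun _ => A, hV.diff_s8 hA, fun _ => hA, ?_, Subsingleton.pairwise,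
        fun _ => Set.disjoint_sdiff_left, by linarith, fun _ => Or.inr fun b hb => ?_⟩
      · rw [Set.iUnion_const, Set.sdiff_union_of_subset hAV]
      · exact (hU b hb).1.trans_le (hbig _ hA2)
    · refine ⟨2, ∅, ![A, V \ A], defOver_empty, ?_, ?_, ?_, fun _ => Set.empty_disjoint _,
        by rwa [hμ.empty], ?_⟩
      · exact Fin.forall_fin_two.2 ⟨hA, hV.diff_s8 hA⟩
      · ext a
        have := @hAV a
        simp [Fin.exists_fin_two]
        tauto
      · intro i j hij
        fin_cases i <;> fin_cases j <;>
          first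
            | exact absurd rfl hij
            | exact Set.disjoint_sdiff_right
            | exact Set.disjoint_sdiff_left
      · exact Fin.forall_fin_two.2
          ⟨Or.inr fun b hb => (hU b hb).1.trans_le (hbig _ hA2),
            Or.inl fun b hb => (hU b hb).2.trans_le (hbig _ hB2)⟩

theorem generically_stable_measure_partition_step
    {L : FirstOrder.Language.{u, v}} {M : Type w} [L.Structure M]
    (hNIP : TheoryIsNIP L M)
    (κ : Cardinal.{w})
    (hκ : Cardinal.lift.{max u v} κ > Cardinal.lift.{w} L.card + Cardinal.aleph0)
    (hsat : IsKappaSaturated L M κ)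
    (M₀ : L.ElementarySubstructure M) (hM₀ : Cardinal.mk (M₀ : Set M) < κ)
    (V W : Set M) (R : M → M → Prop)
    (hV : DefOver L M (M₀ : Set M) V) (hW : DefOver L M (M₀ : Set M) W)
    (hR : DefRelOver L M (M₀ : Set M) R)
    (hRVW : ∀ a b, R a b → a ∈ V ∧ b ∈ W)
    (μ : Set M → ℝ) (hμ : IsKeislerMeasureOn L M V μ)
    (hdef : MeasureDefOver L M (M₀ : Set M) V μ)
    (hfs : MeasureFinSatIn L M (M₀ : Set M) V μ)
    (ε : ℝ) (hε : 0 < ε) :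
    ∃ (m : ℕ) (Wp : Fin m → Set M),
      (∀ j, DefOver L M (M₀ : Set M) (Wp j)) ∧
      (⋃ j, Wp j) = W ∧ Pairwise (Function.onFun Disjoint Wp) ∧
      ∀ j : Fin m, ∃ (n : ℕ) (Z : Set M) (Vp : Fin n → Set M),
        DefOver L M (M₀ : Set M) Z ∧ (∀ i, DefOver L M (M₀ : Set M) (Vp i)) ∧
        Z ∪ (⋃ i, Vp i) = V ∧ Pairwise (Function.onFun Disjoint Vp) ∧
        (∀ i, Disjoint Z (Vp i)) ∧
        μ Z < ε ∧
        ∀ i : Fin n,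
          (∀ b ∈ Wp j, μ (Vp i ∩ {a | R a b}) < ε * μ (Vp i)) ∨
          (∀ b ∈ Wp j, μ (Vp i \ {a | R a b}) < ε * μ (Vp i)) := by
  classical
  have hP : (M₀ : Set M) ⊆ Set.univ := Set.subset_univ _
  rcases lt_or_ge 1 ε with hε1 | hε1
  · refine ⟨1, fun _ => W, fun _ => hW, Set.iUnion_const W, Subsingleton.pairwise,
      fun _ => ⟨0, V, Fin.elim0, hV, fun i => i.elim0, by simp, Subsingleton.pairwise,
        fun i => i.elim0, by rwa [hμ.2.1], fun i => i.elim0⟩⟩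
  have hVu := hV.mono_s8 hP
  have hRu := hR.mono_s8 hP
  have hfib : ∀ b, DefOver L M Set.univ {a | R a b} := fun b => hRu.defOver_left (Set.mem_univ b)
  have hdiff : ∀ b c, DefOver L M Set.univ {a | ¬(R a b ↔ R a c)} := fun b c =>
    hRu.defOver_not_iff (Set.mem_univ b) (Set.mem_univ c)
  obtain ⟨k, hk⟩ := hNIP.exists_not_shattered hR
  obtain ⟨N, hN⟩ := hμ.exists_packing_bound hVu hdiff hk (δ := ε * (ε / 4)) (by positivity)
    (by nlinarith)
  obtain ⟨s, hsM, hs⟩ := exists_finset_net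
    (Close := fun b c => μ (V ∩ {a | ¬(R a b ↔ R a c)}) < ε * (ε / 4))
    (fun b c hbc => by simpa only [iff_comm] using hbc) (M₀ : Set M) hN
  obtain ⟨q, B, hB, hcover, hdisj, happrox⟩ :=
    hdef.exists_partition_not_iff hR (η := ε * (ε / 8)) (by positivity)
  let piece : (s → Fin q) → Set M := fun g => W ∩ ⋂ c : s, B (g c) c
  have hpiece : ∀ g, DefOver L M (M₀ : Set M) (piece g) := fun g =>
    hW.inter_s8 (DefOver.iInter_fintype fun c => hB _ _ (hsM c c.2))
  let e := Fintype.equivFin (s → Fin q)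
  refine ⟨Fintype.card (s → Fin q), fun j => piece (e.symm j), fun j => hpiece _, ?_, ?_, ?_⟩
  · refine Set.Subset.antisymm (Set.iUnion_subset fun j => Set.inter_subset_left) fun b hb => ?_
    have : ∀ c : s, ∃ t, b ∈ B t c := fun c => Set.mem_iUnion.1 (hcover c ▸ Set.mem_univ b)
    choose g hg using this
    exact Set.mem_iUnion.2 ⟨e g, hb, by simpa using fun c hc => hg ⟨c, hc⟩⟩
  · intro i j hij
    obtain ⟨c, hc⟩ := Function.ne_iff.1 (e.symm.injective.ne hij)
    exact Set.disjoint_left.2 fun b hb hb' => Set.disjoint_left.1 (hdisj c hc)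
      (Set.mem_iInter.1 hb.2 c) (Set.mem_iInter.1 hb'.2 c)
  · intro j
    beta_reduce
    generalize e.symm j = g
    rcases (piece g).eq_empty_or_nonempty with hemp | hne
    · exact hμ.exists_homogeneous_partition hV hV subset_rfl hε hε1
        (by simp [hemp])
    · obtain ⟨b₀, hb₀, hb₀M⟩ := (hpiece g).exists_mem_of_nonempty hne
      obtain ⟨c, hcs, hclose⟩ := hs b₀ hb₀M
      have hcV : {a | R a c} ⊆ V := fun a ha => (hRVW a c ha).1
      refine hμ.exists_homogeneous_partition hV (hR.defOver_left (hsM c hcs)) hcV hε hε1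
        fun b hb => ?_
      have happ := happrox (g ⟨c, hcs⟩) c b (Set.mem_iInter.1 hb.2 ⟨c, hcs⟩) b₀
        (Set.mem_iInter.1 hb₀.2 ⟨c, hcs⟩)
      have hlt : μ (V ∩ {a | ¬(R a b ↔ R a c)}) < ε * (ε / 2) := by
        have := (abs_le.1 happ).2
        nlinarith
      have hD := hVu.inter_s8 (hdiff b c)
      refine ⟨(hμ.mono_s8 ((hfib c).diff_s8 (hfib b)) hD ?_ Set.inter_subset_left).trans_lt hlt,
        (hμ.mono_s8 ((hVu.diff_s8 (hfib c)).inter_s8 (hfib b)) hD ?_ Set.inter_subset_left).trans_lt hlt⟩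
      · rintro a ⟨hac, hab⟩
        exact ⟨hcV hac, fun h => hab (h.2 hac)⟩
      · rintro a ⟨⟨haV, hac⟩, hab⟩
        exact ⟨haV, fun h => hac (h.1 hab)⟩
end

section
/- Let M be an L-structure whose theory is NIP. Let φ_V(x,z), φ_W(y,z), φ_R(x,y,z) be L-formulas, and for a parameter tuple c from M set V_c = {a : M ⊨ φ_V(a,c)}, W_c = {b : M ⊨ φ_W(b,c)} and R_c = {(a,b) ∈ V_c × W_c : M ⊨ φ_R(a,b,c)}. Then for every ε > 0 there is N ∈ ℕ such that for every parameter tuple c for which V_c and W_c are finite and nonempty, there are partitions V_c = V₁ ∪ … ∪ V_n and W_c = W₁ ∪ … ∪ W_m with n, m < N and a set E ⊆ {1,…,n} × {1,…,m} such that Σ_{(i,j)∈E} |V_i|·|W_j| < ε·|V_c|·|W_c|, and for every (i,j) ∉ E either |(V_i × W_j) ∩ R_c| < ε·|V_i|·|W_j| or |(V_i × W_j) ∖ R_c| < ε·|V_i|·|W_j|. -/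
/-!
STATEMENT 9: NIP regularity for uniformly definable families of finite graphs.
If `Th(M)` is NIP and `φ_V, φ_W, φ_R` uniformly define bipartite graphs
`(V_c, W_c, R_c)` in `M`, then for every `ε > 0` there is `N` such that every
finite nonempty such graph admits partitions into fewer than `N` parts which are
`ε`-regular off an exceptional set of pairs of density `< ε`.
-/

open FirstOrder

universe u v w

open Classical in
/-- A sequence of length `m` in `W` can be chosen to meet every one of a small number of dense
subsets of `W`. -/
theorem exists_fun_forall_exists_mem {ι β : Type*} {W : Finset β} (hW : W.Nonempty)
    {P : Finset ι} {D : ι → Finset β} {δ : ℝ} {m : ℕ} (hDW : ∀ p ∈ P, D p ⊆ W)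
    (hD : ∀ p ∈ P, δ * W.card ≤ (D p).card) (hP : P.card * (1 - δ) ^ m < 1) :
    ∃ f : Fin m → β, ∀ p ∈ P, ∃ i, f i ∈ D p := by
  let bad : ι → Finset (Fin m → β) := fun p => Fintype.piFinset fun _ => W \ D p
  have hWpos : (0 : ℝ) < W.card := by exact_mod_cast hW.card_pos
  have hbad : ∀ p ∈ P, ((bad p).card : ℝ) ≤ (1 - δ) ^ m * (W.card : ℝ) ^ m := by
    intro p hp
    have hcard : ((W \ D p).card : ℝ) = W.card - (D p).card := by
      rw [Finset.card_sdiff_of_subset (hDW p hp), Nat.cast_sub (Finset.card_le_card (hDW p hp))]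
    have hle : ((W \ D p).card : ℝ) ≤ (1 - δ) * W.card := by
      rw [hcard]
      linarith [hD p hp]
    simp only [bad, Fintype.card_piFinset, Finset.prod_const, Finset.card_univ, Fintype.card_fin]
    push_cast
    rw [← mul_pow]
    gcongr
  have hlt : ((P.biUnion bad).card : ℝ) < (Fintype.piFinset fun _ : Fin m => W).card := by
    calc ((P.biUnion bad).card : ℝ) ≤ ∑ p ∈ P, ((bad p).card : ℝ) := by
          exact_mod_cast Finset.card_biUnion_le
      _ ≤ ∑ _p ∈ P, (1 - δ) ^ m * (W.card : ℝ) ^ m := Finset.sum_le_sum hbad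
      _ = (P.card * (1 - δ) ^ m) * (W.card : ℝ) ^ m := by
          rw [Finset.sum_const, nsmul_eq_mul, mul_assoc]
      _ < 1 * (W.card : ℝ) ^ m := by gcongr
      _ = _ := by simp
  obtain ⟨f, hf, hfb⟩ := Finset.exists_mem_notMem_of_card_lt_card (by exact_mod_cast hlt)
  refine ⟨f, fun p hp => ?_⟩
  by_contra! h
  exact hfb (Finset.mem_biUnion.2 ⟨p, hp, Fintype.mem_piFinset.2 fun i =>
    Finset.mem_sdiff.2 ⟨Fintype.mem_piFinset.1 hf i, h i⟩⟩)

/-- The relation `R` shatters no family of `k` points. -/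
def ShattersNone {α β : Type*} (k : ℕ) (R : α → β → Prop) : Prop :=
  ¬∃ (b : Fin k → β) (a : Set (Fin k) → α), ∀ S i, R (a S) (b i) ↔ i ∈ S

open Classical in
/-- **Sauer–Shelah**, for a relation: `m` points separate only polynomially many elements. -/
theorem ShattersNone.card_le_sum_choose {α β : Type*} {k m : ℕ} {R : α → β → Prop}
    (hR : ShattersNone k R) {T : Finset α} {f : Fin m → β}
    (hf : ∀ a ∈ T, ∀ a' ∈ T, a ≠ a' → ∃ i, ¬(R a (f i) ↔ R a' (f i))) :
    T.card ≤ ∑ i ∈ Finset.range k, m.choose i := by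
  let trace : α → Finset (Fin m) := fun a => {i | R a (f i)}
  have htrace : Set.InjOn trace T := by
    intro a ha a' ha' h
    by_contra hne
    obtain ⟨i, hi⟩ := hf a ha a' ha' hne
    exact hi (by simpa [trace] using Finset.ext_iff.1 h i)
  have hsub : (T.image trace).shatterer ⊆
      (Finset.range k).biUnion fun i => Finset.powersetCard i Finset.univ := by
    intro s hs
    simp only [Finset.mem_biUnion, Finset.mem_range, Finset.mem_powersetCard, Finset.subset_univ,
      true_and]
    refine ⟨s.card, ?_, rfl⟩
    by_contra! hk
    obtain ⟨t, hts, ht⟩ := Finset.exists_subset_card_eq hk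
    have hsh : (T.image trace).Shatters t := (Finset.mem_shatterer.1 hs).mono_right hts
    let e : Fin k ≃ t := (t.equivFinOfCardEq ht).symm
    have key : ∀ S : Set (Fin k), ∃ a, ∀ i, R a (f (e i)) ↔ i ∈ S := by
      intro S
      obtain ⟨u, hu, hut⟩ := hsh (t := ({i | i ∈ S} : Finset (Fin k)).image fun i => (e i : Fin m))
        (by
          intro x hx
          obtain ⟨i, -, rfl⟩ := Finset.mem_image.1 hx
          exact (e i).2)
      obtain ⟨a, -, rfl⟩ := Finset.mem_image.1 hu
      refine ⟨a, fun i => ?_⟩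
      have := Finset.ext_iff.1 hut (e i)
      simpa [trace, Subtype.coe_inj] using this
    choose a ha using key
    exact hR ⟨fun i => f (e i), a, ha⟩
  calc T.card = (T.image trace).card := (Finset.card_image_of_injOn htrace).symm
    _ ≤ (T.image trace).shatterer.card := Finset.card_le_card_shatterer _
    _ ≤ _ := Finset.card_le_card hsub
    _ ≤ ∑ i ∈ Finset.range k, (Finset.powersetCard i (Finset.univ : Finset (Fin m))).card :=
        Finset.card_biUnion_le
    _ = _ := by simp

/-- Exponential decay beats the square of a sum of finitely many binomial coefficients. -/
theorem exists_sq_sum_choose_mul_pow_lt_one (k : ℕ) {r : ℝ} (hr₀ : 0 ≤ r) (hr : r < 1) :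
    ∃ m : ℕ, (((∑ i ∈ Finset.range k, m.choose i) + 1 : ℕ) : ℝ) ^ 2 * r ^ m < 1 := by
  have hlim : Filter.Tendsto (fun m : ℕ => ((k : ℝ) + 1) ^ 2 * ((m : ℝ) ^ (2 * k) * r ^ m))
      Filter.atTop (nhds 0) := by
    simpa using (tendsto_pow_const_mul_const_pow_of_lt_one (2 * k) hr₀ hr).const_mul
      (((k : ℝ) + 1) ^ 2)
  obtain ⟨m, hm, hm₁⟩ :=
    ((hlim.eventually_lt_const one_pos).and (Filter.eventually_ge_atTop 1)).exists
  refine ⟨m, lt_of_le_of_lt ?_ hm⟩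
  have hsum : ∑ i ∈ Finset.range k, m.choose i ≤ k * m ^ k := by
    calc ∑ i ∈ Finset.range k, m.choose i ≤ ∑ _i ∈ Finset.range k, m ^ k :=
          Finset.sum_le_sum fun i hi => (Nat.choose_le_pow m i).trans
            (Nat.pow_le_pow_right hm₁ (Finset.mem_range.1 hi).le)
      _ = k * m ^ k := by simp
  have hle : (∑ i ∈ Finset.range k, m.choose i) + 1 ≤ (k + 1) * m ^ k := by
    have := Nat.one_le_pow k m hm₁
    linarith
  calc _ ≤ (((k + 1) * m ^ k : ℕ) : ℝ) ^ 2 * r ^ m := by gcongr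
    _ = _ := by push_cast; ring

open Classical in
/-- A weak form of **Haussler's packing lemma**. -/
theorem exists_card_le_of_separated (k : ℕ) {δ : ℝ} (hδ₀ : 0 < δ) (hδ₁ : δ ≤ 1) :
    ∃ N : ℕ, ∀ {α : Type v} {β : Type w} {R : α → β → Prop}, ShattersNone k R →
      ∀ {W : Finset β}, W.Nonempty → ∀ {S : Finset α},
        (∀ a ∈ S, ∀ a' ∈ S, a ≠ a' →
          δ * W.card ≤ (W.filter fun b => ¬(R a b ↔ R a' b)).card) →
        S.card ≤ N := by
  obtain ⟨m, hm⟩ := exists_sq_sum_choose_mul_pow_lt_one k (sub_nonneg.2 hδ₁)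
    (sub_lt_self 1 hδ₀)
  refine ⟨∑ i ∈ Finset.range k, m.choose i, fun {α β R} hR {W} hW {S} hS => ?_⟩
  by_contra! hlt
  obtain ⟨T, hTS, hT⟩ := Finset.exists_subset_card_eq (Nat.succ_le_of_lt hlt)
  have hoff : (T.offDiag.card : ℝ) * (1 - δ) ^ m < 1 := by
    refine lt_of_le_of_lt ?_ hm
    have : 0 ≤ 1 - δ := sub_nonneg.2 hδ₁
    gcongr
    rw [← Nat.succ_eq_add_one, ← hT, Finset.offDiag_card, sq]
    exact_mod_cast Nat.sub_le _ _
  obtain ⟨f, hf⟩ := exists_fun_forall_exists_mem hW (P := T.offDiag)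
    (D := fun p => W.filter fun b => ¬(R p.1 b ↔ R p.2 b))
    (fun _ _ => Finset.filter_subset _ _)
    (fun p hp => by
      obtain ⟨h₁, h₂, h₃⟩ := Finset.mem_offDiag.1 hp
      exact hS _ (hTS h₁) _ (hTS h₂) h₃) hoff
  have := hR.card_le_sum_choose (T := T) (f := f) fun a ha a' ha' hne => by
    obtain ⟨i, hi⟩ := hf (a, a') (Finset.mem_offDiag.2 ⟨ha, ha', hne⟩)
    exact ⟨i, (Finset.mem_filter.1 hi).2⟩
  omega

open Classical in
/-- In a relation shattering no `k` points, boundedly many rows approximate every row. -/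
theorem exists_net (k : ℕ) {δ : ℝ} (hδ₀ : 0 < δ) (hδ₁ : δ ≤ 1) :
    ∃ N : ℕ, ∀ {α : Type v} {β : Type w} {R : α → β → Prop}, ShattersNone k R →
      ∀ (V : Finset α) {W : Finset β}, W.Nonempty →
        ∃ S : Finset α, S.card ≤ N ∧ ∀ a ∈ V, ∃ s ∈ S,
          ((W.filter fun b => ¬(R a b ↔ R s b)).card : ℝ) < δ * W.card := by
  obtain ⟨N, hN⟩ := exists_card_le_of_separated k hδ₀ hδ₁
  refine ⟨N, fun {α β R} hR V {W} hW => ?_⟩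
  let sep : Finset α → Prop := fun S => ∀ a ∈ S, ∀ a' ∈ S, a ≠ a' →
    δ * W.card ≤ (W.filter fun b => ¬(R a b ↔ R a' b)).card
  obtain ⟨S, hS, hmax⟩ := (V.powerset.filter sep).exists_max_image Finset.card
    ⟨∅, by simp [sep]⟩
  obtain ⟨hSV, hsep⟩ := Finset.mem_filter.1 hS
  refine ⟨S, hN hR hW hsep, fun a ha => ?_⟩
  by_contra hnear
  have hfar : ∀ s ∈ S, δ * W.card ≤ ((W.filter fun b => ¬(R a b ↔ R s b)).card : ℝ) :=
    fun s hs => not_lt.1 fun h => hnear ⟨s, hs, h⟩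
  have haS : a ∉ S := by
    intro haS
    have hpos : (0 : ℝ) < δ * W.card := mul_pos hδ₀ (by exact_mod_cast hW.card_pos)
    have := hfar a haS
    simp only [not_true_eq_false, Finset.filter_false, Finset.card_empty, Nat.cast_zero] at this
    exact absurd this (not_le.2 hpos)
  have hins : insert a S ∈ V.powerset.filter sep := by
    refine Finset.mem_filter.2 ⟨Finset.mem_powerset.2
      (Finset.insert_subset ha (Finset.mem_powerset.1 hSV)), ?_⟩
    intro x hx y hy hxy
    rcases Finset.mem_insert.1 hx with rfl | hxS <;> rcases Finset.mem_insert.1 hy with rfl | hyS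
    · exact absurd rfl hxy
    · exact hfar y hyS
    · simpa only [iff_comm] using hfar x hxS
    · exact hsep x hxS y hyS hxy
  have := hmax _ hins
  rw [Finset.card_insert_of_notMem haS] at this
  omega

open Classical in
/-- If boundedly many rows approximate every row of a relation, then grouping rows by an
approximating row, and columns by their trace on the approximating rows, gives a partition
almost all of whose pairs are nearly homogeneous. -/
theorem exists_exceptional_pairs_of_approx {α β ι κ : Type*} [Fintype ι]
    [Fintype κ] [DecidableEq ι] [DecidableEq κ] {R : α → β → Prop}
    {V : Finset α} {W : Finset β} (hV : V.Nonempty) {ε δ : ℝ} (hε : 0 < ε)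
    (hδ : δ ≤ ε ^ 2) (p : α → ι) (q : β → κ) (r : ι → α)
    (hp : ∀ a ∈ V, ((W.filter fun b => ¬(R a b ↔ R (r (p a)) b)).card : ℝ) < δ * W.card) :
    ∃ E : Finset (ι × κ),
      ∑ x ∈ E, ((V.filter (p · = x.1)).card : ℝ) * (W.filter (q · = x.2)).card <
        ε * V.card * W.card ∧
      ∀ i j, (i, j) ∉ E →
        (((V ×ˢ W).filter fun y =>
          (p y.1 = i ∧ q y.2 = j) ∧ ¬(R y.1 y.2 ↔ R (r i) y.2)).card : ℝ) <
            ε * (V.filter (p · = i)).card * (W.filter (q · = j)).card := by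
  set err : ι × κ → Finset (α × β) := fun x => (V ×ˢ W).filter fun y =>
    (p y.1 = x.1 ∧ q y.2 = x.2) ∧ ¬(R y.1 y.2 ↔ R (r x.1) y.2)
  have htot : ∑ x, ((err x).card : ℝ) < δ * V.card * W.card := by
    have h₁ : ∑ x, (err x).card =
        ((V ×ˢ W).filter fun y => ¬(R y.1 y.2 ↔ R (r (p y.1)) y.2)).card := by
      rw [Finset.card_eq_sum_card_fiberwise (f := fun y => (p y.1, q y.2)) (t := Finset.univ)
        (fun _ _ => by simp)]
      refine Finset.sum_congr rfl fun x _ => congrArg Finset.card ?_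
      ext y
      simp only [err, Finset.mem_filter, Prod.ext_iff]
      constructor
      · rintro ⟨h, ⟨h₁, h₂⟩, h₃⟩
        exact ⟨⟨h, h₁ ▸ h₃⟩, h₁, h₂⟩
      · rintro ⟨⟨h, h₃⟩, h₁, h₂⟩
        exact ⟨h, ⟨h₁, h₂⟩, h₁ ▸ h₃⟩
    have h₂ : ((V ×ˢ W).filter fun y => ¬(R y.1 y.2 ↔ R (r (p y.1)) y.2)).card =
        ∑ a ∈ V, (W.filter fun b => ¬(R a b ↔ R (r (p a)) b)).card := by
      simp only [Finset.card_filter, Finset.sum_product]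
    rw [← Nat.cast_sum, h₁, h₂, Nat.cast_sum]
    calc _ < ∑ _a ∈ V, δ * W.card := Finset.sum_lt_sum_of_nonempty hV hp
      _ = _ := by rw [Finset.sum_const, nsmul_eq_mul]; ring
  refine ⟨Finset.univ.filter fun x =>
    ε * (V.filter (p · = x.1)).card * (W.filter (q · = x.2)).card ≤ ((err x).card : ℝ), ?_,
    fun i j hij => by simpa [err] using hij⟩
  refine lt_of_mul_lt_mul_left ?_ hε.le
  rw [Finset.mul_sum]
  calc _ ≤ ∑ x ∈ _, ((err x).card : ℝ) := Finset.sum_le_sum fun x hx => by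
        rw [← mul_assoc]
        exact (Finset.mem_filter.1 hx).2
    _ ≤ ∑ x, ((err x).card : ℝ) := Finset.sum_le_sum_of_subset_of_nonneg
        (Finset.filter_subset _ _) fun _ _ _ => Nat.cast_nonneg _
    _ < δ * V.card * W.card := htot
    _ ≤ ε ^ 2 * V.card * W.card := by gcongr
    _ = _ := by ring

/-- If the theory of `M` is NIP, the instances of a formula `φ(x, y, z)` in which the parameter
`z` is fixed are binary relations shattering no `n` points, uniformly in the parameter. -/
theorem TheoryIsNIP.exists_shattersNone {L : FirstOrder.Language.{u, v}} {M : Type w}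
    [L.Structure M] (hNIP : TheoryIsNIP L M) {k : ℕ} (φ : L.Formula ((Unit ⊕ Unit) ⊕ Fin k)) :
    ∃ n : ℕ, ∀ c : Fin k → M, ShattersNone n fun a b : M =>
      φ.Realize (Sum.elim (Sum.elim (fun _ => a) (fun _ => b)) c) := by
  let g : (Unit ⊕ Unit) ⊕ Fin k → Fin 1 ⊕ Fin (k + 1) :=
    Sum.elim (Sum.elim (fun _ => Sum.inl 0) (fun _ => Sum.inr 0)) (fun i => Sum.inr i.succ)
  obtain ⟨n, hn⟩ := hNIP 1 (k + 1) (φ.relabel g)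
  refine ⟨n, fun c ⟨b, a, hab⟩ => hn ⟨fun i => Fin.cons (b i) c, fun S _ => a S, fun S i => ?_⟩⟩
  rw [FirstOrder.Language.Formula.realize_relabel, ← hab S i]
  refine iff_of_eq (congrArg φ.Realize ?_)
  funext x
  rcases x with (x | x) | x <;> simp [g]

theorem nip_regularity_uniformly_definable
    {L : FirstOrder.Language.{u, v}} {M : Type w} [L.Structure M]
    (hNIP : TheoryIsNIP L M)
    (k : ℕ) (φV φW : L.Formula (Unit ⊕ Fin k))
    (φR : L.Formula ((Unit ⊕ Unit) ⊕ Fin k))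
    (ε : ℝ) (hε : 0 < ε) :
    ∃ N : ℕ, ∀ (c : Fin k → M) (V W : Set M) (R : M → M → Prop),
      V = {a | φV.Realize (Sum.elim (fun _ => a) c)} →
      W = {b | φW.Realize (Sum.elim (fun _ => b) c)} →
      (∀ a b, R a b ↔ a ∈ V ∧ b ∈ W ∧
        φR.Realize (Sum.elim (Sum.elim (fun _ => a) (fun _ => b)) c)) →
      V.Finite → V.Nonempty → W.Finite → W.Nonempty →
      ∃ (n m : ℕ), n < N ∧ m < N ∧
        ∃ (Vp : Fin n → Set M) (Wp : Fin m → Set M) (E : Finset (Fin n × Fin m)),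
          (⋃ i, Vp i) = V ∧ Pairwise (Function.onFun Disjoint Vp) ∧
          (⋃ j, Wp j) = W ∧ Pairwise (Function.onFun Disjoint Wp) ∧
          ((∑ q ∈ E, (Nat.card (Vp q.1) : ℝ) * (Nat.card (Wp q.2) : ℝ)) <
            ε * (Nat.card V : ℝ) * (Nat.card W : ℝ)) ∧
          ∀ (i : Fin n) (j : Fin m), (i, j) ∉ E →
            (Nat.card {q : M × M // q.1 ∈ Vp i ∧ q.2 ∈ Wp j ∧ R q.1 q.2} : ℝ) <
                ε * (Nat.card (Vp i) : ℝ) * (Nat.card (Wp j) : ℝ) ∨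
            (Nat.card {q : M × M // q.1 ∈ Vp i ∧ q.2 ∈ Wp j ∧ ¬R q.1 q.2} : ℝ) <
                ε * (Nat.card (Vp i) : ℝ) * (Nat.card (Wp j) : ℝ) := by
  classical
  obtain ⟨d, hd⟩ := hNIP.exists_shattersNone φR
  have hδ₀ : 0 < min (ε ^ 2) 1 := by positivity
  obtain ⟨N, hN⟩ := exists_net d hδ₀ (min_le_right _ _)
  refine ⟨2 ^ N + 1, fun c V W R _ _ hR hVf hVn hWf hWn => ?_⟩
  lift V to Finset M using hVf
  lift W to Finset M using hWf
  rw [Finset.coe_nonempty] at hVn hWn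
  set Q : M → M → Prop := fun a b =>
    φR.Realize (Sum.elim (Sum.elim (fun _ => a) (fun _ => b)) c)
  obtain ⟨S, hSN, hS⟩ := hN (hd c) V hWn
  let r : Fin S.card → M := fun i => S.equivFin.symm i
  have hnet : ∀ a, ∃ i, a ∈ V →
      ((W.filter fun b => ¬(Q a b ↔ Q (r i) b)).card : ℝ) < min (ε ^ 2) 1 * W.card := by
    intro a
    by_cases ha : a ∈ V
    · obtain ⟨s, hs, h⟩ := hS a ha
      exact ⟨S.equivFin ⟨s, hs⟩, fun _ => by simpa [r] using h⟩
    · obtain ⟨s, hs, -⟩ := hS _ hVn.choose_spec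
      exact ⟨S.equivFin ⟨s, hs⟩, fun h => absurd h ha⟩
  choose p hp using hnet
  let e : Finset (Fin S.card) ≃ Fin (2 ^ S.card) := Fintype.equivFinOfCardEq (by simp)
  let q : M → Fin (2 ^ S.card) := fun b => e {i | Q (r i) b}
  have hq : ∀ {b b'}, q b = q b' → ∀ i, Q (r i) b ↔ Q (r i) b' := fun h i => by
    simpa using Finset.ext_iff.1 (e.injective h) i
  have hpow : 2 ^ S.card ≤ 2 ^ N := Nat.pow_le_pow_right two_pos hSN
  obtain ⟨E, hE, hErr⟩ := exists_exceptional_pairs_of_approx (R := Q) (W := W) hVn hε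
    (min_le_left _ _) p q r hp
  refine ⟨S.card, 2 ^ S.card, ?_, Nat.lt_succ_of_le hpow, fun i => V.filter (p · = i),
    fun j => W.filter (q · = j), E, ?_, ?_, ?_, ?_, by simpa using hE, ?_⟩
  · exact (Nat.lt_two_pow_self.trans_le hpow).trans (Nat.lt_succ_self _)
  · ext a; simp
  · intro i j hij
    simp only [Function.onFun, Finset.disjoint_coe]
    exact Finset.disjoint_filter.2 fun a _ h h' => hij (h.symm.trans h')
  · ext b; simp
  · intro i j hij
    simp only [Function.onFun, Finset.disjoint_coe]
    exact Finset.disjoint_filter.2 fun a _ h h' => hij (h.symm.trans h')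
  intro i j hij
  have hcount : ∀ P : M × M → Prop, (∀ y : M × M, y.1 ∈ V → y.2 ∈ W → p y.1 = i → q y.2 = j →
      P y → ¬(Q y.1 y.2 ↔ Q (r i) y.2)) →
      (Nat.card {y : M × M // y.1 ∈ (V.filter (p · = i) : Set M) ∧
        y.2 ∈ (W.filter (q · = j) : Set M) ∧ P y} : ℝ) <
      ε * (Nat.card (V.filter (p · = i) : Set M)) * (Nat.card (W.filter (q · = j) : Set M)) := by
    intro P hP
    simp only [Nat.card_coe_set_eq, Set.ncard_coe_finset]
    refine lt_of_le_of_lt ?_ (hErr i j hij)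
    refine (Nat.cast_le.2 ?_).trans_eq (congrArg Nat.cast (Nat.card_eq_finsetCard _))
    refine Nat.card_le_card_of_injective (fun y => ⟨y.1, ?_⟩) fun _ _ h =>
      Subtype.ext (congrArg (fun z => z.1) h)
    obtain ⟨y, h₁, h₂, h₃⟩ := y
    obtain ⟨h₁, h₁'⟩ := Finset.mem_filter.1 h₁
    obtain ⟨h₂, h₂'⟩ := Finset.mem_filter.1 h₂
    exact Finset.mem_filter.2 ⟨Finset.mem_product.2 ⟨h₁, h₂⟩, ⟨h₁', h₂'⟩, hP y h₁ h₂ h₁' h₂' h₃⟩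
  by_cases hj : ∃ b, q b = j ∧ Q (r i) b
  · obtain ⟨b, hb, hQb⟩ := hj
    refine Or.inr (hcount _ fun y hyV hyW _ hy hn h => hn ?_)
    exact (hR _ _).2 ⟨hyV, hyW, h.2 ((hq (hy.trans hb.symm) i).2 hQb)⟩
  · refine Or.inl (hcount _ fun y hyV hyW _ hy hn h => hj ⟨y.2, hy, h.1 ?_⟩)
    exact ((hR _ _).1 hn).2.2
end

section
/- Let M be an L-structure whose theory is NIP, and let V, W be definable sets in M and R ⊆ V × W a definable relation (all with parameters from M). Then for every ε > 0 there is N ∈ ℕ such that for all finite nonempty subsets V₀ ⊆ V and W₀ ⊆ W there are partitions V₀ = V₁ ∪ … ∪ V_n and W₀ = W₁ ∪ … ∪ W_m with n, m < N and a set E ⊆ {1,…,n} × {1,…,m} such that Σ_{(i,j)∈E} |V_i|·|W_j| < ε·|V₀|·|W₀|, and for every (i,j) ∉ E either |(V_i × W_j) ∩ R| < ε·|V_i|·|W_j| or |(V_i × W_j) ∖ R| < ε·|V_i|·|W_j|. -/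
/-!
STATEMENT 10: NIP regularity for finite induced subgraphs of a definable bipartite
graph.  If `Th(M)` is NIP and `(V, W, R)` is a bipartite graph definable in `M`,
then for every `ε > 0` there is `N` such that every pair of finite nonempty subsets
`V₀ ⊆ V`, `W₀ ⊆ W` admits partitions into fewer than `N` parts which are `ε`-regular
off an exceptional set of pairs of density `< ε`.
-/

open FirstOrder

universe u v w

/-- The relation `R` shatters no set of `k` elements of `β`. -/
def NoShatter {α β : Type*} (R : α → β → Prop) (k : ℕ) : Prop :=
  ¬∃ (b : Fin k → β) (a : Set (Fin k) → α), ∀ S i, R (a S) (b i) ↔ i ∈ S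

open Classical in
/-- If every pair in `P` is separated by a proportion at least `δ` of the points of `W`, then some
`m` points of `W` separate all but a proportion `(1 - δ) ^ m` of the pairs. -/
lemma exists_separating_finset {α β : Type*} (R : α → β → Prop) (W : Finset β)
    (hW : W.Nonempty) {δ : ℝ} (hδ : δ ≤ 1) (P : Finset (α × α))
    (hP : ∀ p ∈ P, δ * W.card ≤ (W.filter fun b => ¬(R p.1 b ↔ R p.2 b)).card) (m : ℕ) :
    ∃ T ⊆ W, T.card ≤ m ∧
      ((P.filter fun p => ∀ b ∈ T, (R p.1 b ↔ R p.2 b)).card : ℝ) ≤ (1 - δ) ^ m * P.card := by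
  induction m with
  | zero => exact ⟨∅, by simp, by simp, by simp⟩
  | succ m ih =>
    obtain ⟨T, hTW, hTm, hT⟩ := ih
    set Q := P.filter fun p => ∀ b ∈ T, (R p.1 b ↔ R p.2 b) with hQ
    have hsum : ∑ _b ∈ W, δ * (Q.card : ℝ)
        ≤ ∑ b ∈ W, ((Q.filter fun p => ¬(R p.1 b ↔ R p.2 b)).card : ℝ) := by
      have hcomm := Finset.sum_card_bipartiteAbove_eq_sum_card_bipartiteBelow
        (s := W) (t := Q) (fun b p => ¬(R p.1 b ↔ R p.2 b))
      simp only [Finset.bipartiteAbove, Finset.bipartiteBelow] at hcomm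
      rw [← Nat.cast_sum, hcomm, Nat.cast_sum, Finset.sum_const, nsmul_eq_mul]
      calc (W.card : ℝ) * (δ * Q.card) = ∑ _p ∈ Q, δ * (W.card : ℝ) := by
            rw [Finset.sum_const, nsmul_eq_mul]; ring
        _ ≤ _ := Finset.sum_le_sum fun p hp => hP p (Finset.mem_filter.1 hp).1
    obtain ⟨b, hb, hbQ⟩ := Finset.exists_le_of_sum_le hW hsum
    refine ⟨insert b T, Finset.insert_subset hb hTW,
      (Finset.card_insert_le _ _).trans (by omega), ?_⟩
    have hrest : (P.filter fun p => ∀ x ∈ insert b T, (R p.1 x ↔ R p.2 x))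
        = Q.filter fun p => (R p.1 b ↔ R p.2 b) := by
      ext p
      simp only [hQ, Finset.mem_filter, Finset.forall_mem_insert]
      tauto
    have hsplit := Finset.card_filter_add_card_filter_not (s := Q) (fun p => (R p.1 b ↔ R p.2 b))
    have hsplit' : ((Q.filter fun p => (R p.1 b ↔ R p.2 b)).card : ℝ)
        + (Q.filter fun p => ¬(R p.1 b ↔ R p.2 b)).card = Q.card := by exact_mod_cast hsplit
    rw [hrest]
    calc ((Q.filter fun p => (R p.1 b ↔ R p.2 b)).card : ℝ) ≤ (1 - δ) * Q.card := by linarith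
      _ ≤ (1 - δ) * ((1 - δ) ^ m * P.card) := mul_le_mul_of_nonneg_left hT (by linarith)
      _ = (1 - δ) ^ (m + 1) * P.card := by ring

open Classical in
/-- A form of the Sauer-Shelah bound on the number of traces on a finite set. -/
lemma NoShatter.card_le {α β : Type*} {R : α → β → Prop} {k : ℕ} (hR : NoShatter R k)
    (T : Finset β) (S : Finset α)
    (hS : ∀ a ∈ S, ∀ a' ∈ S, (∀ b ∈ T, (R a b ↔ R a' b)) → a = a') :
    S.card ≤ k * (T.card + 1) ^ k := by
  set 𝒜 : Finset (Finset β) := S.image fun a => T.filter (R a) with h𝒜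
  have hcard : S.card = 𝒜.card := by
    rw [h𝒜, Finset.card_image_of_injOn]
    intro a ha a' ha' h
    refine hS a ha a' ha' fun b hb => ?_
    have := Finset.ext_iff.1 h b
    simpa [hb] using this
  have hsub : 𝒜.shatterer ⊆ (Finset.range k).biUnion fun i => T.powersetCard i := by
    intro U hU
    rw [Finset.mem_shatterer] at hU
    have hUT : U ⊆ T := by
      obtain ⟨A, hA, hUA⟩ := hU (Finset.Subset.refl U)
      obtain ⟨a, -, rfl⟩ := Finset.mem_image.1 hA
      intro x hx
      rw [← hUA] at hx
      simp only [Finset.mem_inter, Finset.mem_filter] at hx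
      exact hx.2.1
    simp only [Finset.mem_biUnion, Finset.mem_range, Finset.mem_powersetCard]
    refine ⟨U.card, ?_, hUT, rfl⟩
    by_contra! hk
    let b : Fin k → β := fun i => (U.equivFin.symm (Fin.castLE hk i) : β)
    have hbU : ∀ i, b i ∈ U := fun i => Subtype.prop _
    have hb : Function.Injective b := fun i j h =>
      Fin.castLE_injective hk (U.equivFin.symm.injective (Subtype.ext h))
    have key : ∀ X : Set (Fin k), ∃ a, ∀ i, R a (b i) ↔ i ∈ X := by
      intro X
      obtain ⟨A, hA, hUA⟩ := hU (Finset.filter_subset (fun x => ∃ i ∈ X, b i = x) U)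
      obtain ⟨a, -, rfl⟩ := Finset.mem_image.1 hA
      refine ⟨a, fun i => ?_⟩
      have := Finset.ext_iff.1 hUA (b i)
      simp only [Finset.mem_inter, Finset.mem_filter, hbU i, hUT (hbU i), true_and] at this
      rw [this]
      exact ⟨fun ⟨j, hj, hji⟩ => hb hji ▸ hj, fun hi => ⟨i, hi, rfl⟩⟩
    choose a ha using key
    exact hR ⟨b, a, ha⟩
  calc S.card = 𝒜.card := hcard
    _ ≤ 𝒜.shatterer.card := 𝒜.card_le_card_shatterer
    _ ≤ ((Finset.range k).biUnion fun i => T.powersetCard i).card := Finset.card_le_card hsub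
    _ ≤ ∑ i ∈ Finset.range k, (T.powersetCard i).card := Finset.card_biUnion_le
    _ ≤ ∑ _i ∈ Finset.range k, (T.card + 1) ^ k := by
        refine Finset.sum_le_sum fun i hi => ?_
        rw [Finset.card_powersetCard]
        exact (Nat.choose_le_pow _ _).trans <| (Nat.pow_le_pow_left (Nat.le_succ _) i).trans <|
          Nat.pow_le_pow_right (Nat.succ_pos _) (Finset.mem_range.1 hi).le
    _ = k * (T.card + 1) ^ k := by simp

lemma exists_mul_pow_lt_two_pow (k c : ℕ) : ∃ t : ℕ, k * (c * t + 1) ^ k < 2 ^ t := by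
  have ho := isLittleO_pow_const_const_pow_of_one_lt (R := ℝ) k (r := 2) one_lt_two
  have hpos : (0 : ℝ) < 1 / ((k + 1) * (c + 1) ^ k) := by positivity
  obtain ⟨t, ht, ht1⟩ := ((ho.bound hpos).and (Filter.eventually_ge_atTop 1)).exists
  refine ⟨t, ?_⟩
  rw [Real.norm_of_nonneg (by positivity), Real.norm_of_nonneg (by positivity),
    one_div_mul_eq_div, le_div_iff₀ (by positivity)] at ht
  have h1 : t ^ k * ((k + 1) * (c + 1) ^ k) ≤ 2 ^ t := by exact_mod_cast ht
  have hle : (c * t + 1) ^ k ≤ (c + 1) ^ k * t ^ k := by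
    rw [← mul_pow]
    exact Nat.pow_le_pow_left (by nlinarith) k
  have hp : 0 < t ^ k * (c + 1) ^ k := by positivity
  calc k * (c * t + 1) ^ k ≤ k * ((c + 1) ^ k * t ^ k) := Nat.mul_le_mul_left _ hle
    _ < t ^ k * ((k + 1) * (c + 1) ^ k) := by nlinarith
    _ ≤ 2 ^ t := h1

open Classical in
/-- A packing bound: `δ`-separated families have size bounded in terms of `δ` and `k` only. -/
lemma exists_packing_bound (k : ℕ) {δ : ℝ} (hδ0 : 0 < δ) (hδ1 : δ < 1) :
    ∃ B : ℕ, ∀ {α β : Type w} (R : α → β → Prop), NoShatter R k →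
      ∀ W : Finset β, W.Nonempty → ∀ S : Finset α,
      (∀ a ∈ S, ∀ a' ∈ S, a ≠ a' →
        δ * W.card ≤ (W.filter fun b => ¬(R a b ↔ R a' b)).card) → S.card ≤ B := by
  obtain ⟨c, hc⟩ := exists_pow_lt_of_lt_one (show (0 : ℝ) < 1 / 4 by norm_num)
    (show 1 - δ < 1 by linarith)
  obtain ⟨t, ht⟩ := exists_mul_pow_lt_two_pow k c
  refine ⟨2 ^ t, fun {α β} R hR W hW S hS => ?_⟩
  by_contra! hlt
  obtain ⟨S', hS'S, hS'⟩ := Finset.exists_subset_card_eq hlt.le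
  obtain ⟨T, -, hTm, hT⟩ := exists_separating_finset R W hW hδ1.le S'.offDiag
    (fun p hp => by
      rw [Finset.mem_offDiag] at hp
      exact hS _ (hS'S hp.1) _ (hS'S hp.2.1) hp.2.2) (c * t)
  have hoff : (S'.offDiag.card : ℝ) < 4 ^ t := by
    have h4 : (4 : ℕ) ^ t = 2 ^ t * 2 ^ t := by rw [← mul_pow]; norm_num
    have hp : 0 < 2 ^ t * 2 ^ t := by positivity
    have : S'.offDiag.card < 4 ^ t := by
      rw [Finset.offDiag_card, hS', h4]
      exact Nat.sub_lt hp (by positivity)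
    exact_mod_cast this
  have hzero : (S'.offDiag.filter fun p => ∀ b ∈ T, (R p.1 b ↔ R p.2 b)).card = 0 := by
    have hpow : (1 - δ) ^ (c * t) ≤ (1 / 4 : ℝ) ^ t := by
      rw [pow_mul]
      exact pow_le_pow_left₀ (pow_nonneg (by linarith) _) hc.le t
    have h1 : (1 - δ) ^ (c * t) * (S'.offDiag.card : ℝ) < 1 := by
      calc (1 - δ) ^ (c * t) * (S'.offDiag.card : ℝ)
          ≤ (1 / 4 : ℝ) ^ t * S'.offDiag.card := mul_le_mul_of_nonneg_right hpow (by positivity)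
        _ < (1 / 4 : ℝ) ^ t * 4 ^ t := mul_lt_mul_of_pos_left hoff (by positivity)
        _ = 1 := by rw [← mul_pow]; norm_num
    exact Nat.lt_one_iff.1 (by exact_mod_cast hT.trans_lt h1)
  rw [Finset.card_eq_zero, Finset.filter_eq_empty_iff] at hzero
  have hcard := hR.card_le T S' fun a ha a' ha' h => by
    by_contra hne
    exact hzero (x := (a, a')) (Finset.mem_offDiag.2 ⟨ha, ha', hne⟩) h
  rw [hS'] at hcard
  have : k * (T.card + 1) ^ k ≤ k * (c * t + 1) ^ k :=
    Nat.mul_le_mul_left _ (Nat.pow_le_pow_left (by omega) k)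
  omega

open Classical in
/-- A maximal `δ`-separated subset is a `δ`-net. -/
lemma exists_separated_net {α β : Type*} (R : α → β → Prop) (V : Finset α) (W : Finset β)
    (d : ℝ) (hd : 0 ≤ d) :
    ∃ C ⊆ V, (∀ a ∈ C, ∀ a' ∈ C, a ≠ a' →
        d ≤ (W.filter fun b => ¬(R a b ↔ R a' b)).card) ∧
      ∀ a ∈ V, ∃ c ∈ C, ((W.filter fun b => ¬(R a b ↔ R c b)).card : ℝ) ≤ d := by
  obtain ⟨C, hC, hmax⟩ := Finset.exists_max_image
    (V.powerset.filter fun C => ∀ a ∈ C, ∀ a' ∈ C, a ≠ a' →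
      d ≤ (W.filter fun b => ¬(R a b ↔ R a' b)).card) Finset.card ⟨∅, by simp⟩
  simp only [Finset.mem_filter, Finset.mem_powerset] at hC hmax
  refine ⟨C, hC.1, hC.2, fun a ha => ?_⟩
  by_contra hnot
  have hfar : ∀ c ∈ C, d < (W.filter fun b => ¬(R a b ↔ R c b)).card :=
    fun c hc => not_le.1 fun hle => hnot ⟨c, hc, hle⟩
  have haC : a ∉ C := fun h => by
    have := hfar a h
    simp at this
    linarith
  have hle := hmax (insert a C) ⟨Finset.insert_subset ha hC.1, ?_⟩
  · rw [Finset.card_insert_of_notMem haC] at hle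
    omega
  · intro x hx y hy hxy
    rcases Finset.mem_insert.1 hx with hxa | hx <;> rcases Finset.mem_insert.1 hy with hya | hy
    · exact absurd (hxa.trans hya.symm) hxy
    · exact hxa ▸ (hfar y hy).le
    · simp only [hya, iff_comm (a := R x _)]
      exact (hfar x hx).le
    · exact hC.2 x hx y hy hxy

open Classical in
/-- Regularity lemma for a bipartite graph of bounded VC dimension, with the parts given as the
fibres of colourings `f` and `g`. -/
lemma exists_homogeneous_colouring (k : ℕ) {ε : ℝ} (hε : 0 < ε) :
    ∃ N : ℕ, ∀ {α β : Type w} (R : α → β → Prop), NoShatter R k →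
      ∀ (V : Finset α) (W : Finset β), V.Nonempty → W.Nonempty →
      ∃ n m : ℕ, n < N ∧ m < N ∧ ∃ (f : α → Fin n) (g : β → Fin m) (E : Finset (Fin n × Fin m)),
        (∑ q ∈ E, ((V.filter (f · = q.1)).card : ℝ) * ((W.filter (g · = q.2)).card : ℝ)
          < ε * V.card * W.card) ∧
        ∀ i j, (i, j) ∉ E →
          ((((V.filter (f · = i)) ×ˢ (W.filter (g · = j))).filter
            fun p => R p.1 p.2).card : ℝ) <
              ε * (V.filter (f · = i)).card * (W.filter (g · = j)).card ∨
          ((((V.filter (f · = i)) ×ˢ (W.filter (g · = j))).filter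
            fun p => ¬R p.1 p.2).card : ℝ) <
              ε * (V.filter (f · = i)).card * (W.filter (g · = j)).card := by
  set δ : ℝ := min (ε ^ 2 / 2) (1 / 2) with hδ
  have hδ0 : 0 < δ := lt_min (by positivity) (by norm_num)
  have hδ1 : δ < 1 := (min_le_right _ _).trans_lt (by norm_num)
  have hδε : δ < ε ^ 2 := (min_le_left _ _).trans_lt (by have := pow_pos hε 2; linarith)
  obtain ⟨B, hB⟩ := exists_packing_bound.{w} k hδ0 hδ1
  refine ⟨2 ^ B + 1, fun {α β} R hR V W hV hW => ?_⟩
  have hVpos : (0 : ℝ) < V.card := by exact_mod_cast hV.card_pos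
  have hWpos : (0 : ℝ) < W.card := by exact_mod_cast hW.card_pos
  obtain ⟨C, -, hsep, hnet⟩ := exists_separated_net R V W (δ * W.card) (by positivity)
  have hCB : C.card ≤ B := hB R hR W hW C hsep
  obtain ⟨a₀, ha₀⟩ := hV
  obtain ⟨c₀, hc₀, -⟩ := hnet a₀ ha₀
  have hcentre : ∀ a : α, ∃ c : C, a ∈ V →
      ((W.filter fun b => ¬(R a b ↔ R c b)).card : ℝ) ≤ δ * W.card := fun a => by
    by_cases ha : a ∈ V
    · obtain ⟨c, hc, h⟩ := hnet a ha
      exact ⟨⟨c, hc⟩, fun _ => h⟩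
    · exact ⟨⟨c₀, hc₀⟩, fun h => absurd h ha⟩
  choose z hz using hcentre
  let e := Fintype.equivFin C
  let e' := Fintype.equivFin (C → Prop)
  let f : α → Fin (Fintype.card C) := fun a => e (z a)
  let g : β → Fin (Fintype.card (C → Prop)) := fun b => e' fun c => R c b
  let bad : Finset (α × β) := (V ×ˢ W).filter fun p => ¬(R p.1 p.2 ↔ R (z p.1) p.2)
  have hbad : (bad.card : ℝ) ≤ δ * W.card * V.card := by
    have h : bad.card = ∑ a ∈ V, (W.filter fun b => ¬(R a b ↔ R (z a) b)).card := by
      simp only [bad, Finset.card_filter, Finset.sum_product]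
    rw [h, Nat.cast_sum]
    calc _ ≤ ∑ _a ∈ V, δ * (W.card : ℝ) := Finset.sum_le_sum fun a ha => hz a ha
      _ = _ := by rw [Finset.sum_const, nsmul_eq_mul]; ring
  let cell : Fin (Fintype.card C) × Fin (Fintype.card (C → Prop)) → Finset (α × β) :=
    fun q => bad.filter fun p => (f p.1, g p.2) = q
  let E : Finset (Fin (Fintype.card C) × Fin (Fintype.card (C → Prop))) :=
    Finset.univ.filter fun q =>
      ε * (V.filter (f · = q.1)).card * (W.filter (g · = q.2)).card ≤ (cell q).card
  refine ⟨_, _, ?_, ?_, f, g, E, ?_, ?_⟩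
  · rw [Fintype.card_coe]
    exact Nat.lt_succ_of_le (hCB.trans (Nat.lt_two_pow_self).le)
  · rw [Fintype.card_fun, Fintype.card_prop, Fintype.card_coe]
    exact Nat.lt_succ_of_le (Nat.pow_le_pow_right two_pos hCB)
  · have hcells : ∑ q ∈ E, ((cell q).card : ℝ) ≤ bad.card := by
      have h : bad.card = ∑ q, (cell q).card :=
        Finset.card_eq_sum_card_fiberwise fun _ _ => Finset.mem_coe.2 (Finset.mem_univ _)
      rw [h, Nat.cast_sum]
      exact Finset.sum_le_sum_of_subset_of_nonneg (Finset.subset_univ _)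
        fun _ _ _ => Nat.cast_nonneg _
    have hmul : ε * ∑ q ∈ E, ((V.filter (f · = q.1)).card : ℝ) * ((W.filter (g · = q.2)).card : ℝ)
        ≤ ∑ q ∈ E, ((cell q).card : ℝ) := by
      rw [Finset.mul_sum]
      refine Finset.sum_le_sum fun q hq => ?_
      rw [← mul_assoc]
      exact (Finset.mem_filter.1 hq).2
    refine lt_of_mul_lt_mul_left ?_ hε.le
    calc _ ≤ δ * W.card * V.card := hmul.trans (hcells.trans hbad)
      _ = δ * (W.card * V.card) := by ring
      _ < ε ^ 2 * (W.card * V.card) := mul_lt_mul_of_pos_right hδε (by positivity)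
      _ = ε * (ε * V.card * W.card) := by ring
  · intro i j hij
    have hlt : ((cell (i, j)).card : ℝ)
        < ε * (V.filter (f · = i)).card * (W.filter (g · = j)).card := by
      simpa [E] using hij
    have hcentre_iff : ∀ a b, f a = i → g b = j → (R (z a) b ↔ e'.symm j (e.symm i)) := by
      rintro a b rfl rfl
      simp [f, g]
    by_cases hRij : e'.symm j (e.symm i)
    · right
      refine lt_of_le_of_lt (Nat.cast_le.2 (Finset.card_le_card ?_)) hlt
      rintro ⟨a, b⟩ hp
      simp only [Finset.mem_filter, Finset.mem_product] at hp
      obtain ⟨⟨⟨ha, hai⟩, hb, hbj⟩, hn⟩ := hp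
      have := (hcentre_iff a b hai hbj).2 hRij
      simp [cell, bad, ha, hb, hai, hbj, hn, this]
    · left
      refine lt_of_le_of_lt (Nat.cast_le.2 (Finset.card_le_card ?_)) hlt
      rintro ⟨a, b⟩ hp
      simp only [Finset.mem_filter, Finset.mem_product] at hp
      obtain ⟨⟨⟨ha, hai⟩, hb, hbj⟩, hn⟩ := hp
      have : ¬R (z a) b := fun h => hRij ((hcentre_iff a b hai hbj).1 h)
      simp [cell, bad, ha, hb, hai, hbj, hn, this]

/-- A binary relation definable with parameters in a structure with NIP theory shatters no set of
some fixed finite size. -/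
lemma DefRelOver.exists_noShatter {L : FirstOrder.Language.{u, v}} {M : Type w} [L.Structure M]
    (hNIP : TheoryIsNIP L M) {P : Set M} {R : M → M → Prop} (hR : DefRelOver L M P R) :
    ∃ k, NoShatter R k := by
  obtain ⟨l, φ, c, -, hφ⟩ := hR
  let ρ : (Unit ⊕ Unit) ⊕ Fin l → Fin 1 ⊕ Fin (l + 1) :=
    Sum.elim (Sum.elim (fun _ => Sum.inl 0) fun _ => Sum.inr 0) fun i => Sum.inr i.succ
  obtain ⟨k, hk⟩ := hNIP 1 (l + 1) (φ.relabel ρ)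
  refine ⟨k, fun ⟨b, a, hab⟩ => hk ⟨fun i => Fin.cons (b i) c, fun S _ => a S, fun S i => ?_⟩⟩
  rw [← hab, hφ, FirstOrder.Language.Formula.realize_relabel]
  refine iff_of_eq (congrArg _ ?_)
  funext x
  rcases x with (_ | _) | x <;> simp [ρ]

theorem nip_regularity_finite_subgraphs
    {L : FirstOrder.Language.{u, v}} {M : Type w} [L.Structure M]
    (hNIP : TheoryIsNIP L M)
    (V W : Set M) (R : M → M → Prop)
    (hV : DefOver L M Set.univ V) (hW : DefOver L M Set.univ W)
    (hR : DefRelOver L M Set.univ R)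
    (hRVW : ∀ a b, R a b → a ∈ V ∧ b ∈ W)
    (ε : ℝ) (hε : 0 < ε) :
    ∃ N : ℕ, ∀ (V₀ W₀ : Set M),
      V₀ ⊆ V → W₀ ⊆ W → V₀.Finite → V₀.Nonempty → W₀.Finite → W₀.Nonempty →
      ∃ (n m : ℕ), n < N ∧ m < N ∧
        ∃ (Vp : Fin n → Set M) (Wp : Fin m → Set M) (E : Finset (Fin n × Fin m)),
          (⋃ i, Vp i) = V₀ ∧ Pairwise (Function.onFun Disjoint Vp) ∧
          (⋃ j, Wp j) = W₀ ∧ Pairwise (Function.onFun Disjoint Wp) ∧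
          ((∑ q ∈ E, (Nat.card (Vp q.1) : ℝ) * (Nat.card (Wp q.2) : ℝ)) <
            ε * (Nat.card V₀ : ℝ) * (Nat.card W₀ : ℝ)) ∧
          ∀ (i : Fin n) (j : Fin m), (i, j) ∉ E →
            (Nat.card {q : M × M // q.1 ∈ Vp i ∧ q.2 ∈ Wp j ∧ R q.1 q.2} : ℝ) <
                ε * (Nat.card (Vp i) : ℝ) * (Nat.card (Wp j) : ℝ) ∨
            (Nat.card {q : M × M // q.1 ∈ Vp i ∧ q.2 ∈ Wp j ∧ ¬R q.1 q.2} : ℝ) <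
                ε * (Nat.card (Vp i) : ℝ) * (Nat.card (Wp j) : ℝ) := by
  classical
  obtain ⟨k, hk⟩ := hR.exists_noShatter hNIP
  obtain ⟨N, hN⟩ := exists_homogeneous_colouring.{w} k hε
  refine ⟨N, fun V₀ W₀ _ _ hVf hVn hWf hWn => ?_⟩
  lift V₀ to Finset M using hVf
  lift W₀ to Finset M using hWf
  obtain ⟨n, m, hn, hm, f, g, E, hE, hreg⟩ :=
    hN R hk V₀ W₀ (Finset.coe_nonempty.1 hVn) (Finset.coe_nonempty.1 hWn)
  refine ⟨n, m, hn, hm, fun i => ↑(V₀.filter (f · = i)), fun j => ↑(W₀.filter (g · = j)), E,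
    ?_, ?_, ?_, ?_, ?_, ?_⟩
  · ext a
    simp
  · intro i i' hii'
    exact Finset.disjoint_coe.2 (Finset.disjoint_filter.2 fun a _ h h' => hii' (h.symm.trans h'))
  · ext b
    simp
  · intro j j' hjj'
    exact Finset.disjoint_coe.2 (Finset.disjoint_filter.2 fun a _ h h' => hjj' (h.symm.trans h'))
  · simpa only [Nat.card_coe_set_eq, Set.ncard_coe_finset] using hE
  · intro i j hij
    have hcount : ∀ (A B : Finset M) (Q : M → M → Prop),
        Nat.card {q : M × M // q.1 ∈ (A : Set M) ∧ q.2 ∈ (B : Set M) ∧ Q q.1 q.2}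
          = ((A ×ˢ B).filter fun p => Q p.1 p.2).card := fun A B Q =>
      Nat.subtype_card _ fun p => by simp [and_assoc]
    simp only [hcount _ _ R, hcount _ _ fun a b => ¬R a b, Nat.card_coe_set_eq,
      Set.ncard_coe_finset]
    convert hreg i j hij
end
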